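/- arXiv:2509.02574 — 2 statements merged into one kernel-verified Lean document; each statement's English description precedes it below -/
import Mathlib

section
/- Let B = diag(x_1^{r_1}x_2^{s_1},..., x_1^{r_k}x_2^{s_k}, x_1^{r}x_2^{s} I_{l−k}) · V · diag(I_k, x_1 I_{l−k}), where V ∈ R^{l×l} is a unimodular matrix whose entries lie in K[x_2,...,x_n] (not involving x_1), r_1 ≤ r_2 ≤ ... ≤ r_k ≤ r, s_1 ≤ s_2 ≤ ... ≤ s_k ≤ s, and neither x_1 nor x_2 divides d_1(B) (i.e., r_1 = s_1 = 0). If J_i(B) = R and d_i(B) is associated to x_1^{r_1+...+r_i} x_2^{s_1+...+s_i} for i = 1,2,...,k, then B is equivalent to B_1 = diag(x_1^{r_1}x_2^{s_1},..., x_1^{r_k}x_2^{s_k}, x_1^{r+1}x_2^{s} I_{l−k}). -/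
open Matrix MvPolynomial

/-- The set of `k × k` minors of a matrix: determinants of submatrices obtained by
choosing `k` rows and `k` columns. -/
def minorsSet {R : Type*} [CommRing R] {l m : ℕ} (k : ℕ)
    (F : Matrix (Fin l) (Fin m) R) : Set R :=
  { d | ∃ (ri : Fin k → Fin l) (ci : Fin k → Fin m),
      Function.Injective ri ∧ Function.Injective ci ∧ d = (F.submatrix ri ci).det }

/-- `d` is a greatest common divisor of the `k × k` minors of `F`. -/
def IsGcdMinors {R : Type*} [CommRing R] {l m : ℕ} (k : ℕ)
    (F : Matrix (Fin l) (Fin m) R) (d : R) : Prop :=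
  (∀ a ∈ minorsSet k F, d ∣ a) ∧ ∀ e : R, (∀ a ∈ minorsSet k F, e ∣ a) → e ∣ d

/-- `J_k(F) = R` : the ideal generated by the reduced `k`-th order minors
(the `k × k` minors divided by their g.c.d.) is the unit ideal. -/
def JEqTop {R : Type*} [CommRing R] {l m : ℕ} (k : ℕ)
    (F : Matrix (Fin l) (Fin m) R) : Prop :=
  ∃ d : R, IsGcdMinors k F d ∧ Ideal.span { b : R | d * b ∈ minorsSet k F } = ⊤

/-- The normal rank of a polynomial matrix: its rank over the fraction field. -/
noncomputable def normalRank {K : Type*} [Field K] {n l m : ℕ}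
    (F : Matrix (Fin l) (Fin m) (MvPolynomial (Fin n) K)) : ℕ :=
  (F.map (algebraMap (MvPolynomial (Fin n) K)
      (FractionRing (MvPolynomial (Fin n) K)))).rank

/-- Equivalence of matrices: `G = M * F * N` with `M`, `N` unimodular
(i.e. with determinant a unit, a nonzero constant). -/
def MatEquiv {R : Type*} [CommRing R] {l m : ℕ}
    (F G : Matrix (Fin l) (Fin m) R) : Prop :=
  ∃ (M : Matrix (Fin l) (Fin l) R) (N : Matrix (Fin m) (Fin m) R),
    IsUnit M.det ∧ IsUnit N.det ∧ G = M * F * N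

/-- A matrix is zero left prime (ZLP) if its maximal (row-size) order minors
generate the unit ideal. -/
def ZLP {R : Type*} [CommRing R] {l m : ℕ} (F : Matrix (Fin l) (Fin m) R) : Prop :=
  Ideal.span (minorsSet l F) = ⊤

/-- Two row vectors are equivalent if an invertible matrix carries one to the other. -/
def RowEquiv {R : Type*} [CommRing R] {ι : Type*} [Fintype ι] [DecidableEq ι]
    (v w : ι → R) : Prop :=
  ∃ U : Matrix ι ι R, IsUnit U.det ∧ v ᵥ* U = w

namespace RowEquiv

section Basic

variable {R S : Type*} [CommRing R] [CommRing S] {ι κ : Type*} [Fintype ι] [DecidableEq ι]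
  [Fintype κ] [DecidableEq κ]

theorem refl (v : ι → R) : RowEquiv v v := ⟨1, by simp, by simp⟩

theorem symm {v w : ι → R} (h : RowEquiv v w) : RowEquiv w v := by
  obtain ⟨U, hU, rfl⟩ := h
  refine ⟨U⁻¹, ?_, ?_⟩
  · exact (Matrix.isUnit_nonsing_inv_det_iff).2 hU
  · rw [vecMul_vecMul, mul_nonsing_inv _ hU, vecMul_one]

theorem trans {u v w : ι → R} (h : RowEquiv u v) (h' : RowEquiv v w) : RowEquiv u w := by
  obtain ⟨U, hU, rfl⟩ := h
  obtain ⟨U', hU', rfl⟩ := h'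
  exact ⟨U * U', by rw [det_mul]; exact hU.mul hU', by rw [vecMul_vecMul]⟩

theorem map (f : R →+* S) {v w : ι → R} (h : RowEquiv v w) :
    RowEquiv (fun i => f (v i)) (fun i => f (w i)) := by
  obtain ⟨U, hU, rfl⟩ := h
  refine ⟨U.map f, ?_, ?_⟩
  · rw [← RingHom.mapMatrix_apply, ← RingHom.map_det]
    exact hU.map f
  · ext j
    simp [vecMul, dotProduct]

theorem reindex (e : ι ≃ κ) {v w : ι → R} (h : RowEquiv v w) :
    RowEquiv (v ∘ e.symm) (w ∘ e.symm) := by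
  obtain ⟨U, hU, rfl⟩ := h
  refine ⟨Matrix.reindex e e U, by rwa [det_reindex_self], ?_⟩
  ext j
  simp only [vecMul, dotProduct, reindex_apply, submatrix_apply, Function.comp_apply]
  exact Fintype.sum_equiv e.symm _ _ fun _ => rfl

theorem perm (e : Equiv.Perm ι) (v : ι → R) : RowEquiv v (v ∘ e) := by
  refine ⟨(e.permMatrix R)ᵀ, ?_, ?_⟩
  · rw [det_transpose, det_permutation]
    exact (Units.isUnit (Equiv.Perm.sign e)).map (Int.castRingHom R)
  · rw [vecMul_transpose]
    ext j
    simp [Equiv.Perm.permMatrix, mulVec, dotProduct, PEquiv.toMatrix_apply, Equiv.toPEquiv_apply]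

theorem single (s t : ι) : RowEquiv (Pi.single s (1 : R)) (Pi.single t 1) := by
  convert perm (Equiv.swap s t) (Pi.single s (1 : R)) using 1
  ext j
  simp only [Pi.single_apply, Function.comp_apply]
  congr 1
  rw [eq_iff_iff, Equiv.swap_apply_eq_iff, Equiv.swap_apply_left]

theorem sumElim {p p' : ι → R} {q q' : κ → R} (U : Matrix ι ι R) (hU : IsUnit U.det)
    (C : Matrix ι κ R) (hp : p ᵥ* U = p') (hq : p ᵥ* C + q = q') :
    RowEquiv (Sum.elim p q) (Sum.elim p' q') := by
  refine ⟨fromBlocks U C 0 1, by simpa [det_fromBlocks_zero₂₁] using hU, ?_⟩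
  rw [vecMul_fromBlocks]
  simp only [vecMul_zero, vecMul_one, add_zero, Sum.elim_comp_inl, Sum.elim_comp_inr, hp, hq]

theorem sumElim_add (p : ι → R) (q : κ → R) (H : Matrix κ ι R) :
    RowEquiv (Sum.elim p q) (Sum.elim (p + q ᵥ* H) q) := by
  refine ⟨fromBlocks 1 0 H 1, by simp, ?_⟩
  rw [vecMul_fromBlocks]
  simp only [vecMul_zero, vecMul_one, zero_add, Sum.elim_comp_inl, Sum.elim_comp_inr]

end Basic

section Suslin

open Polynomial in
/-- Suslin's lemma: if `c` lies in the ideal generated by `f` and `g`, then the values of `(f, g)`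
at two points congruent modulo `c` differ by an invertible `2 × 2` matrix, and modulo these values
every other polynomial has equal values at the two points. -/
theorem comp_of_dvd {A : Type*} [CommRing A] [IsDomain A] {κ : Type*} [Fintype κ] [DecidableEq κ]
    {f g u v : A[X]} {q : κ → A[X]} {c : A} (hc : c ≠ 0)
    (huv : f * u + g * v = Polynomial.C c) {b b' : A[X]} (hb : Polynomial.C c ∣ b' - b) :
    RowEquiv (Sum.elim ![f.comp b, g.comp b] fun i => (q i).comp b)
      (Sum.elim ![f.comp b', g.comp b'] fun i => (q i).comp b') := by
  have hC : (Polynomial.C c : A[X]) ≠ 0 := by simpa using hc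
  have key : ∀ p : A[X], Polynomial.C c ∣ p.comp b' - p.comp b := fun p => by
    refine hb.trans ?_
    simpa [Polynomial.comp, Polynomial.eval₂_eq_eval_map] using
      Polynomial.sub_dvd_eval_sub b' b (p.map Polynomial.C)
  choose δ hδ using key
  have e1 : f.comp b * u.comp b + g.comp b * v.comp b = Polynomial.C c := by
    simpa using congrArg (fun p => p.comp b) huv
  have hf := hδ f
  have hg := hδ g
  have hu := hδ u
  have hv := hδ v
  have ef : f.comp b' = f.comp b + Polynomial.C c * δ f := by rw [← hf]; ring
  have eg : g.comp b' = g.comp b + Polynomial.C c * δ g := by rw [← hg]; ring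
  have eu : u.comp b' = u.comp b + Polynomial.C c * δ u := by rw [← hu]; ring
  have ev : v.comp b' = v.comp b + Polynomial.C c * δ v := by rw [← hv]; ring
  have e2 : f.comp b' * u.comp b' + g.comp b' * v.comp b' = Polynomial.C c := by
    simpa using congrArg (fun p => p.comp b') huv
  set F := f.comp b
  set G := g.comp b
  set U := u.comp b
  set W := v.comp b
  let M : Matrix (Fin 2) (Fin 2) A[X] :=
    !![1 + U * δ f + G * δ v, U * δ g - G * δ u; W * δ f - F * δ v, 1 + W * δ g + F * δ u]
  refine sumElim M ?_ (Matrix.of ![fun i => U * δ (q i), fun i => W * δ (q i)]) ?_ ?_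
  · have h00 : Polynomial.C c * M 0 0 = f.comp b' * U + v.comp b' * G := by
      simp only [M, of_apply, cons_val', cons_val_zero, cons_val_fin_one]
      rw [ef, ev]; linear_combination -e1
    have h01 : Polynomial.C c * M 0 1 = g.comp b' * U - u.comp b' * G := by
      simp only [M, of_apply, cons_val', cons_val_zero, cons_val_one, cons_val_fin_one]
      rw [eg, eu]; ring
    have h10 : Polynomial.C c * M 1 0 = f.comp b' * W - v.comp b' * F := by
      simp only [M, of_apply, cons_val', cons_val_zero, cons_val_one, cons_val_fin_one]
      rw [ef, ev]; ring
    have h11 : Polynomial.C c * M 1 1 = g.comp b' * W + u.comp b' * F := by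
      simp only [M, of_apply, cons_val', cons_val_one, cons_val_fin_one]
      rw [eg, eu]; linear_combination -e1
    have : Polynomial.C c * Polynomial.C c * M.det = Polynomial.C c * Polynomial.C c := by
      calc _ = (Polynomial.C c * M 0 0) * (Polynomial.C c * M 1 1)
            - (Polynomial.C c * M 0 1) * (Polynomial.C c * M 1 0) := by rw [det_fin_two]; ring
        _ = (f.comp b' * u.comp b' + g.comp b' * v.comp b') * (F * U + G * W) := by
            rw [h00, h01, h10, h11]; ring
        _ = _ := by rw [e1, e2]
    have : M.det = 1 := by
      apply mul_left_cancel₀ (mul_ne_zero hC hC)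
      rw [this, mul_one]
    simp [this]
  · ext j : 1
    fin_cases j
    · simp [M, vecMul, dotProduct, Fin.sum_univ_two]
      rw [ef]; linear_combination δ f * e1
    · simp [M, vecMul, dotProduct, Fin.sum_univ_two]
      rw [eg]; linear_combination δ g * e1
  · ext j : 1
    simp
    linear_combination δ (q j) * e1 - hδ (q j)

end Suslin

end RowEquiv

theorem exists_isCoprime_add_mul {R : Type*} [CommRing R] [IsDomain R] [IsPrincipalIdealRing R]
    {a b c : R} (ha : a ≠ 0) (h : ∀ p, Prime p → p ∣ a → p ∣ b → ¬ p ∣ c) :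
    ∃ t, IsCoprime a (b + c * t) := by
  classical
  refine ⟨((UniqueFactorizationMonoid.factors a).filter (¬ · ∣ b)).prod, ?_⟩
  refine isCoprime_of_prime_dvd (fun h0 => ha h0.1) fun p hp hpa hpd => ?_
  obtain ⟨q, hq, hpq⟩ :=
    UniqueFactorizationMonoid.exists_mem_factors_of_dvd ha hp.irreducible hpa
  by_cases hpb : p ∣ b
  · have hpt := (Prime.dvd_or_dvd hp ((dvd_add_right hpb).1 hpd)).resolve_left (h p hp hpa hpb)
    obtain ⟨r, hr, hpr⟩ := hp.exists_mem_multiset_dvd hpt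
    obtain ⟨hr, hrb⟩ := Multiset.mem_filter.1 hr
    have hass := hp.irreducible.associated_of_dvd
      (UniqueFactorizationMonoid.irreducible_of_factor r hr) hpr
    exact hrb (hass.symm.dvd.trans hpb)
  · refine hpb ((dvd_add_left (Dvd.dvd.mul_left ?_ c)).1 hpd)
    refine hpq.dvd.trans (Multiset.dvd_prod (Multiset.mem_filter.2 ⟨hq, ?_⟩))
    exact fun hqb => hpb (hpq.dvd.trans hqb)

open Polynomial in
/-- If the row `(f, g, q)` over `A[X]` is unimodular and `f` has invertible leading coefficient,
then adding multiples of the `q i` to `g` makes the ideal `(f, g)` meet `A` outside a given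
maximal ideal. -/
theorem exists_notMem_maximal_mem_span {A : Type*} [CommRing A] {κ : Type*} [Fintype κ]
    (m : Ideal A) [m.IsMaximal] {f g a b : A[X]} {q w : κ → A[X]}
    (hf : IsUnit f.leadingCoeff) (h : f * a + g * b + ∑ i, q i * w i = 1) :
    ∃ t : κ → A[X], ∃ c ∉ m, ∃ u v, f * u + (g + ∑ i, q i * t i) * v = Polynomial.C c := by
  let φ : A[X] →+* (A ⧸ m)[X] := Polynomial.mapRingHom (Ideal.Quotient.mk m)
  let : Field (A ⧸ m) := Ideal.Quotient.field m
  have hφ : Function.Surjective φ := Polynomial.map_surjective _ Ideal.Quotient.mk_surjective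
  have hf0 : φ f ≠ 0 := by
    intro h0
    have := congrArg (fun p => Polynomial.coeff p f.natDegree) h0
    rw [Polynomial.coeff_zero, coe_mapRingHom, Polynomial.coeff_map, coeff_natDegree] at this
    exact (hf.map (Ideal.Quotient.mk m)).ne_zero this
  obtain ⟨d, hd⟩ := IsPrincipalIdealRing.principal (Ideal.span (Set.range fun i => φ (q i)))
  have hdq : ∀ i, d ∣ φ (q i) := fun i => by
    have : φ (q i) ∈ Ideal.span (Set.range fun i => φ (q i)) :=
      Ideal.subset_span (Set.mem_range_self i)
    rw [hd] at this
    exact Ideal.mem_span_singleton.1 this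
  have hdm : d ∈ Ideal.span (Set.range fun i => φ (q i)) := by
    rw [hd]; exact Submodule.mem_span_singleton_self d
  obtain ⟨s, hs⟩ := (Ideal.mem_span_range_iff_exists_fun).1 hdm
  obtain ⟨t, ht⟩ := exists_isCoprime_add_mul (a := φ f) (b := φ g) (c := d) hf0 (by
    intro p hp hpf hpg hpd
    refine hp.not_isUnit (isUnit_of_dvd_one ?_)
    rw [← map_one φ, ← h, map_add, map_add, map_sum, map_mul, map_mul]
    refine dvd_add (dvd_add (hpf.mul_right _) (hpg.mul_right _)) (Finset.dvd_sum fun i _ => ?_)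
    rw [map_mul]
    exact (hpd.trans (hdq i)).mul_right _)
  choose t' ht' using fun i => hφ (s i * t)
  refine ⟨t', ?_⟩
  set G := g + ∑ i, q i * t' i with hG
  have hGφ : φ G = φ g + d * t := by
    rw [hG, map_add, map_sum, ← hs, Finset.sum_mul]
    congr 1
    refine Finset.sum_congr rfl fun i _ => ?_
    rw [map_mul, ht']; ring
  rw [← hGφ] at ht
  obtain ⟨u, v, huv⟩ := ht
  obtain ⟨u, rfl⟩ := hφ u
  obtain ⟨v, rfl⟩ := hφ v
  let I : Ideal A[X] := Ideal.span {f, G}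
  have hfin : Module.Finite A (A[X] ⧸ I) := by
    have : Module.Finite A (A[X] ⧸ Ideal.span {hf.unit⁻¹ • f}) :=
      (monic_of_isUnit_leadingCoeff_inv_smul hf).finite_adjoinRoot
    have hle : Ideal.span {hf.unit⁻¹ • f} ≤ I := by
      rw [Ideal.span_singleton_le_iff_mem]
      exact Submodule.smul_of_tower_mem _ hf.unit⁻¹.val (Ideal.subset_span (by simp))
    exact Module.Finite.of_surjective
      (Ideal.Quotient.factorₐ A hle).toLinearMap (Ideal.Quotient.factor_surjective hle)
  have htop : (⊤ : Submodule A (A[X] ⧸ I)) ≤ m • ⊤ := by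
    rintro x -
    obtain ⟨p, rfl⟩ := Ideal.Quotient.mk_surjective x
    set e := p * (1 - (u * f + v * G)) with he
    have hpe : Ideal.Quotient.mk I p = Ideal.Quotient.mk I e := by
      rw [Ideal.Quotient.eq, he]
      have : u * f + v * G ∈ I := Ideal.mem_span_pair.2 ⟨u, v, rfl⟩
      convert I.mul_mem_left p this using 1
      ring
    have he0 : φ e = 0 := by
      rw [he, map_mul, map_sub, map_one, map_add, map_mul, map_mul, huv]; ring
    have hcoeff : ∀ n, e.coeff n ∈ m := fun n => by
      rw [← Ideal.Quotient.eq_zero_iff_mem, ← Polynomial.coeff_map, ← coe_mapRingHom, he0,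
        Polynomial.coeff_zero]
    rw [hpe, e.as_sum_support_C_mul_X_pow, map_sum]
    refine Submodule.sum_mem _ fun n _ => ?_
    rw [← Polynomial.smul_eq_C_mul]
    exact Submodule.smul_mem_smul (hcoeff n)
      (Submodule.mem_top (x := Ideal.Quotient.mk I (Polynomial.X ^ n)))
  obtain ⟨c, hcm, hc⟩ := Submodule.exists_sub_one_mem_and_smul_eq_zero_of_fg_of_le_smul m
    (⊤ : Submodule A (A[X] ⧸ I)) hfin.fg_top htop
  refine ⟨c, fun hcm' => ?_, ?_⟩
  · have : (1 : A) ∈ m := by simpa using m.sub_mem hcm' hcm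
    exact (Ideal.ne_top_iff_one m).1 (Ideal.IsMaximal.ne_top ‹_›) this
  · have h1 := hc (Ideal.Quotient.mk I 1) trivial
    have : Polynomial.C c ∈ I := by
      rw [← Ideal.Quotient.eq_zero_iff_mem, ← h1, ← mul_one (Polynomial.C c),
        ← Polynomial.smul_eq_C_mul]
      rfl
    obtain ⟨u, v, huv⟩ := Ideal.mem_span_pair.1 this
    exact ⟨u, v, by rw [← huv]; ring⟩

open Polynomial in
/-- A unimodular row over `A[X]`, one of whose entries has invertible leading coefficient, is
equivalent to its value at any point. -/
theorem RowEquiv.comp_comp {A : Type*} [CommRing A] [IsDomain A] {κ : Type*} [Fintype κ]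
    [DecidableEq κ] {F W : Fin 2 ⊕ κ → A[X]} (hF : IsUnit (F (Sum.inl 0)).leadingCoeff)
    (h : ∑ i, F i * W i = 1) (b b' : A[X]) :
    RowEquiv (fun i => (F i).comp b) (fun i => (F i).comp b') := by
  let J : Ideal A :=
    { carrier := {c | ∀ b b' : A[X], Polynomial.C c ∣ b' - b →
        RowEquiv (fun i => (F i).comp b) (fun i => (F i).comp b')}
      zero_mem' := fun b b' hb => by
        rw [map_zero, zero_dvd_iff, sub_eq_zero] at hb
        rw [hb]
        exact .refl _
      add_mem' := fun {c d} hc hd b b' ⟨t, ht⟩ => by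
        refine (hc b (b + Polynomial.C c * t) ⟨t, by ring⟩).trans (hd _ _ ⟨t, ?_⟩)
        rw [map_add] at ht
        linear_combination ht
      smul_mem' := fun a c hc b b' hb => by
        refine hc b b' ((Dvd.intro_left (Polynomial.C a) ?_).trans hb)
        rw [smul_eq_mul, map_mul] }
  suffices hJ : J = ⊤ by
    have h1 : (1 : A) ∈ J := by rw [hJ]; trivial
    exact h1 b b' (by simp)
  by_contra hJ
  obtain ⟨m, hm, hJm⟩ := Ideal.exists_le_maximal J hJ
  rw [Fintype.sum_sum_type, Fin.sum_univ_two] at h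
  obtain ⟨t, c, hcm, u, v, huv⟩ := exists_notMem_maximal_mem_span m hF h
  refine hcm (hJm fun b b' hb => ?_)
  have key : ∀ x : A[X], RowEquiv (fun i => (F i).comp x)
      (Sum.elim ![(F (Sum.inl 0)).comp x,
        (F (Sum.inl 1) + ∑ i, F (Sum.inr i) * t i).comp x] fun i => (F (Sum.inr i)).comp x) := by
    intro x
    convert RowEquiv.sumElim_add (fun i => (F (Sum.inl i)).comp x)
      (fun i => (F (Sum.inr i)).comp x) (Matrix.of fun i => ![0, (t i).comp x]) using 1
    · ext i : 1
      rcases i with i | i <;> rfl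
    · congr 1
      ext i : 1
      fin_cases i
      · simp [vecMul, dotProduct]
      · simp [vecMul, dotProduct, Polynomial.comp, Polynomial.eval₂_finsetSum]
  have hc : c ≠ 0 := fun h0 => hcm (h0 ▸ m.zero_mem)
  exact ((key b).trans (RowEquiv.comp_of_dvd hc huv hb)).trans (key b').symm

theorem RowEquiv.single_of_isUnit {R : Type*} [CommRing R] {ι : Type*} [Fintype ι]
    [DecidableEq ι] {v : ι → R} {s : ι} (h : IsUnit (v s)) : RowEquiv v (Pi.single s 1) := by
  obtain ⟨u, hu⟩ := h
  let z : ι → R := fun j => if j = s then ↑u⁻¹ - 1 else - (↑u⁻¹ * v j)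
  refine ⟨1 + Matrix.replicateCol Unit (Pi.single s (1 : R)) * Matrix.replicateRow Unit z, ?_, ?_⟩
  · rw [det_one_add_replicateCol_mul_replicateRow]
    simp [z]
  · ext j
    rw [← vecMulVec_eq, vecMul_add, vecMul_one, vecMul_vecMulVec]
    by_cases hj : j = s
    · subst hj
      simp [z, ← hu, mul_sub]
    · simp [z, hj, ← hu]

section MonicChangeOfVariables

variable {K : Type*} [Field K] {n : ℕ}

/-- The change of variables `X i ↦ X i + c X 0 ^ (N ^ i)` for `i ≠ 0`, fixing `X 0`. -/
noncomputable abbrev shearHom (n N : ℕ) (c : K) :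
    MvPolynomial (Fin (n + 1)) K →ₐ[K] MvPolynomial (Fin (n + 1)) K :=
  aeval fun i ↦ if i = 0 then X 0 else X i + c • X 0 ^ N ^ (i : ℕ)

theorem shearHom_comp (N : ℕ) {c d : K} (h : c + d = 0) :
    (shearHom n N c).comp (shearHom n N d) = AlgHom.id _ _ := by
  obtain rfl : d = -c := (neg_eq_of_add_eq_zero_right h).symm
  rw [comp_aeval, ← MvPolynomial.aeval_X_left]
  ext i v
  cases i using Fin.cases <;> simp

/-- The invertible change of variables `X i ↦ X i + X 0 ^ (N ^ i)` for `i ≠ 0`. -/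
noncomputable def shear (K : Type*) [Field K] (n N : ℕ) :
    MvPolynomial (Fin (n + 1)) K ≃ₐ[K] MvPolynomial (Fin (n + 1)) K :=
  AlgEquiv.ofAlgHom (shearHom n N 1) (shearHom n N (-1))
    (shearHom_comp N (by ring)) (shearHom_comp N (by ring))

theorem leadingCoeff_finSuccEquiv_shear_X {N : ℕ} (hN : 0 < N) (i : Fin (n + 1)) :
    (finSuccEquiv K n (shear K n N (X i))).leadingCoeff = 1 := by
  cases i using Fin.cases with
  | zero => simp [shear, finSuccEquiv_X_zero]
  | succ i =>
    simp [shear, finSuccEquiv_X_succ, finSuccEquiv_X_zero, add_comm,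
      Polynomial.leadingCoeff_X_pow_add_C (pow_pos hN _)]

theorem natDegree_finSuccEquiv_shear_X {N : ℕ} (i : Fin (n + 1)) :
    (finSuccEquiv K n (shear K n N (X i))).natDegree = N ^ (i : ℕ) := by
  cases i using Fin.cases with
  | zero => simp [shear, finSuccEquiv_X_zero]
  | succ i => simp [shear, finSuccEquiv_X_succ, finSuccEquiv_X_zero, add_comm]

theorem finSuccEquiv_shear_monomial (N : ℕ) (v : Fin (n + 1) →₀ ℕ)
    (a : K) :
    finSuccEquiv K n (shear K n N (monomial v a)) =
      Polynomial.C (C a) * ∏ i, finSuccEquiv K n (shear K n N (X i)) ^ v i := by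
  rw [monomial_eq, Finsupp.prod_pow v fun a ↦ X a, map_mul, map_mul, map_prod, map_prod]
  congr 1
  · simp [shear, finSuccEquiv_apply]
  · simp

theorem leadingCoeff_finSuccEquiv_shear_monomial {N : ℕ} (hN : 0 < N) (v : Fin (n + 1) →₀ ℕ)
    (a : K) :
    (finSuccEquiv K n (shear K n N (monomial v a))).leadingCoeff = C a := by
  rw [finSuccEquiv_shear_monomial, Polynomial.leadingCoeff_mul, Polynomial.leadingCoeff_prod]
  simp [Polynomial.leadingCoeff_pow, leadingCoeff_finSuccEquiv_shear_X hN]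

theorem natDegree_finSuccEquiv_shear_monomial {N : ℕ} (hN : 0 < N) (v : Fin (n + 1) →₀ ℕ)
    {a : K} (ha : a ≠ 0) :
    (finSuccEquiv K n (shear K n N (monomial v a))).natDegree =
      ∑ i : Fin (n + 1), N ^ (i : ℕ) * v i := by
  have h0 : ∀ i : Fin (n + 1), finSuccEquiv K n (shear K n N (X i)) ^ v i ≠ 0 := fun i =>
    pow_ne_zero _ (Polynomial.leadingCoeff_ne_zero.1
      (by rw [leadingCoeff_finSuccEquiv_shear_X hN]; exact one_ne_zero))
  rw [finSuccEquiv_shear_monomial, Polynomial.natDegree_mul (by simpa using ha)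
    (Finset.prod_ne_zero_iff.2 fun i _ => h0 i), Polynomial.natDegree_prod _ _ fun i _ => h0 i]
  simp [Polynomial.natDegree_pow, natDegree_finSuccEquiv_shear_X, mul_comm]

theorem sum_pow_mul_ne {N : ℕ} (hN : 1 < N) {v w : Fin (n + 1) →₀ ℕ} (hv : ∀ i, v i < N)
    (hw : ∀ i, w i < N) (hne : v ≠ w) :
    ∑ i : Fin (n + 1), N ^ (i : ℕ) * v i ≠ ∑ i : Fin (n + 1), N ^ (i : ℕ) * w i := by
  intro h
  refine hne <| Finsupp.ext <| congrFun <| List.ofFn_inj.mp ?_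
  apply Nat.ofDigits_inj_of_len_eq hN (by simp)
  · intro a ha
    obtain ⟨i, rfl⟩ := List.mem_ofFn.1 ha
    exact hv i
  · intro a ha
    obtain ⟨i, rfl⟩ := List.mem_ofFn.1 ha
    exact hw i
  · simpa only [Nat.ofDigits_eq_sum_mapIdx, List.mapIdx_eq_ofFn, List.get_ofFn, List.length_ofFn,
      Fin.val_cast, mul_comm, List.sum_ofFn] using! h

/-- After a change of variables, a nonzero polynomial over a field has invertible leading
coefficient with respect to the variable `X 0`. -/
theorem exists_isUnit_leadingCoeff_finSuccEquiv {f : MvPolynomial (Fin (n + 1)) K} (hf : f ≠ 0) :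
    ∃ e : MvPolynomial (Fin (n + 1)) K ≃ₐ[K] MvPolynomial (Fin (n + 1)) K,
      IsUnit (finSuccEquiv K n (e f)).leadingCoeff := by
  classical
  set N := 2 + f.totalDegree with hN
  refine ⟨shear K n N, ?_⟩
  have hlt : ∀ v ∈ f.support, ∀ i, v i < N := fun v hv i =>
    ((monomial_le_degreeOf i hv).trans (degreeOf_le_totalDegree f i)).trans_lt (by omega)
  set h := fun v => finSuccEquiv K n (shear K n N (monomial v (coeff v f)))
  obtain ⟨v, hv, hmax⟩ := Finset.exists_max_image f.support (fun v => (h v).natDegree)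
    (support_nonempty.mpr hf)
  have hc : coeff v f ≠ 0 := mem_support_iff.1 hv
  have hlead : (h v).leadingCoeff = C (coeff v f) :=
    leadingCoeff_finSuccEquiv_shear_monomial (by omega) v _
  have hv0 : h v ≠ 0 := Polynomial.leadingCoeff_ne_zero.1 (by rw [hlead]; simpa using hc)
  have hsum : finSuccEquiv K n (shear K n N f) = ∑ w ∈ f.support.erase v, h w + h v := by
    rw [Finset.sum_erase_add _ _ hv, ← map_sum, ← map_sum, support_sum_monomial_coeff]
  have hdeg : (∑ w ∈ f.support.erase v, h w).degree < (h v).degree := by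
    refine (Polynomial.degree_sum_le _ _).trans_lt
      ((Finset.sup_lt_iff (Ne.bot_lt fun h0 => hv0 (Polynomial.degree_eq_bot.1 h0))).2
        fun w hw => ?_)
    obtain ⟨hwv, hw⟩ := Finset.mem_erase.1 hw
    refine Polynomial.degree_lt_degree (lt_of_le_of_ne (hmax w hw) ?_)
    rw [natDegree_finSuccEquiv_shear_monomial (by omega) w (mem_support_iff.1 hw),
      natDegree_finSuccEquiv_shear_monomial (by omega) v hc]
    exact sum_pow_mul_ne (by omega) (hlt w hw) (hlt v hv) hwv
  rw [hsum, Polynomial.leadingCoeff_add_of_degree_lt hdeg, hlead]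
  exact hc.isUnit.map C

end MonicChangeOfVariables

/-- **Quillen–Suslin theorem for unimodular rows**: every unimodular row over a polynomial ring
over a field is equivalent to a standard basis row. -/
theorem RowEquiv.single_of_unimodular {K : Type*} [Field K] {ι : Type*} [Fintype ι]
    [DecidableEq ι] {n : ℕ} {v w : ι → MvPolynomial (Fin n) K} (h : ∑ i, v i * w i = 1) (t : ι) :
    RowEquiv v (Pi.single t 1) := by
  induction n with
  | zero =>
    obtain ⟨s, hs⟩ : ∃ s, v s ≠ 0 := by
      by_contra! h0
      simp [h0] at h
    refine (RowEquiv.single_of_isUnit (s := s) ?_).trans (.single s t)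
    obtain ⟨a, ha⟩ := C_surjective (Fin 0) (v s)
    rw [← ha]
    refine IsUnit.map C (Ne.isUnit fun ha0 => hs ?_)
    rw [← ha, ha0, map_zero]
  | succ n ih =>
    obtain ⟨s, hs⟩ : ∃ s, v s ≠ 0 := by
      by_contra! h0
      simp [h0] at h
    rcases subsingleton_or_nontrivial ι with hι | hι
    · have : Unique ι := ⟨⟨t⟩, fun _ => Subsingleton.elim _ _⟩
      rw [Fintype.sum_unique] at h
      exact .single_of_isUnit (IsUnit.of_mul_eq_one _ (Subsingleton.elim default t ▸ h))
    obtain ⟨m, hm⟩ : ∃ m, Fintype.card ι = 2 + m := Nat.exists_eq_add_of_le Fintype.one_lt_card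
    obtain ⟨e, hes⟩ : ∃ e : Fin 2 ⊕ Fin m ≃ ι, e (Sum.inl 0) = s := by
      let e₀ : Fin 2 ⊕ Fin m ≃ ι := finSumFinEquiv.trans (Fintype.equivFinOfCardEq hm).symm
      exact ⟨e₀.trans (Equiv.swap (e₀ (Sum.inl 0)) s), by simp⟩
    obtain ⟨T, hT⟩ := exists_isUnit_leadingCoeff_finSuccEquiv hs
    let Φ := T.trans (finSuccEquiv K n)
    have hΦ : ∑ i, Φ (v i) * Φ (w i) = 1 := by
      rw [← map_one Φ, ← h, map_sum]
      exact Finset.sum_congr rfl fun i _ => (map_mul Φ _ _).symm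
    have h1 : RowEquiv (fun i => (Φ (v (e i))).comp Polynomial.X)
        (fun i => (Φ (v (e i))).comp 0) :=
      RowEquiv.comp_comp (W := fun i => Φ (w (e i))) (by rw [hes]; exact hT)
        (by rw [← hΦ]; exact Fintype.sum_equiv e _ _ fun _ => rfl) _ _
    have h2 : RowEquiv (fun i => (Φ (v i)).eval 0) (Pi.single t 1) := by
      refine ih (w := fun i => (Φ (w i)).eval 0) ?_
      simpa [Polynomial.eval_finsetSum] using congrArg (Polynomial.eval 0) hΦ
    have h3 := (h1.reindex e).trans (w := Pi.single t 1) (by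
      convert h2.map Polynomial.C using 1
      · ext i : 1
        simp [Polynomial.comp_zero]
      · ext i : 1
        by_cases hi : i = t <;> simp [hi])
    convert h3.map Φ.symm.toRingEquiv.toRingHom using 1
    · ext i : 1
      simp
    · ext i : 1
      by_cases hi : i = t <;> simp [hi]

section MatrixRows

variable {R : Type*} [CommRing R]

theorem mul_row_of_row_eq_one {ι : Type*} [Fintype ι] [DecidableEq ι] {A : Matrix ι ι R} {i : ι}
    (h : A i = (1 : Matrix ι ι R) i) (B : Matrix ι ι R) : (A * B) i = B i := by
  rw [mul_apply_eq_vecMul, h, ← mul_apply_eq_vecMul, one_mul]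

theorem inv_row_eq_one {ι : Type*} [Fintype ι] [DecidableEq ι] {A : Matrix ι ι R}
    (hA : IsUnit A.det) {i : ι} (h : A i = (1 : Matrix ι ι R) i) :
    A⁻¹ i = (1 : Matrix ι ι R) i := by
  have := mul_row_of_row_eq_one h A⁻¹
  rw [← this, mul_nonsing_inv _ hA]

variable {K : Type*} [Field K] {n l : ℕ}

/-- A row which is unimodular in the columns satisfying `T` can be carried to a standard basis row
by an invertible matrix which is trivial in the rows outside `T`. -/
theorem exists_vecMul_eq_single {ι : Type*} [Fintype ι] [DecidableEq ι] (T : ι → Prop)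
    [DecidablePred T] {t : ι} (ht : T t) {v w : ι → MvPolynomial (Fin n) K}
    (h : ∑ j, v j * w j = 1) (hw : ∀ j, ¬ T j → w j = 0) :
    ∃ Q : Matrix ι ι (MvPolynomial (Fin n) K), IsUnit Q.det ∧
      (∀ i, ¬ T i → Q i = (1 : Matrix ι ι _) i) ∧ v ᵥ* Q = (1 : Matrix ι ι _) t := by
  have hT : ∑ j : {j // T j}, v j * w j = 1 := by
    rw [← Fintype.sum_subtype_add_sum_subtype T] at h
    rw [← h, left_eq_add]
    exact Finset.sum_eq_zero fun j _ => by rw [hw j j.2, mul_zero]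
  obtain ⟨U, hU, hvU⟩ := RowEquiv.single_of_unimodular (v := fun j : {j // T j} => v j)
    (w := fun j => w j) hT ⟨t, ht⟩
  let C : Matrix {j // T j} {j // ¬ T j} (MvPolynomial (Fin n) K) :=
    Matrix.of fun i j => -(U i ⟨t, ht⟩ * v j)
  let Q := Matrix.reindex (Equiv.sumCompl T) (Equiv.sumCompl T) (fromBlocks U C 0 1)
  have hQ₁ : ∀ (i) (hi : T i) (j) (hj : T j), Q i j = U ⟨i, hi⟩ ⟨j, hj⟩ := fun i hi j hj => by
    simp [Q, Equiv.sumCompl_symm_apply_of_pos, hi, hj]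
  have hQ₂ : ∀ (i) (hi : T i) (j) (hj : ¬ T j), Q i j = -(U ⟨i, hi⟩ ⟨t, ht⟩ * v j) :=
    fun i hi j hj => by
      simp [Q, C, Equiv.sumCompl_symm_apply_of_pos, Equiv.sumCompl_symm_apply_of_neg, hi, hj]
  have hQ₃ : ∀ i, ¬ T i → Q i = (1 : Matrix ι ι _) i := fun i hi => by
    ext1 j
    by_cases hj : T j
    · have : i ≠ j := fun h => hi (h ▸ hj)
      simp [Q, Equiv.sumCompl_symm_apply_of_pos, Equiv.sumCompl_symm_apply_of_neg, hi, hj, this]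
    · simp [Q, Equiv.sumCompl_symm_apply_of_neg, hi, hj, one_apply]
  refine ⟨Q, by simpa [Q, det_fromBlocks_zero₂₁] using hU, hQ₃, ?_⟩
  ext1 j
  rw [vecMul, dotProduct, ← Fintype.sum_subtype_add_sum_subtype T]
  have hzero : ∀ (f : {i // ¬ T i} → MvPolynomial (Fin n) K),
      (∀ i : {i // ¬ T i}, (i : ι) ≠ j → f i = 0) →
      ∑ i, f i = if hj : T j then 0 else f ⟨j, hj⟩ := fun f hf => by
    split_ifs with hj
    · exact Finset.sum_eq_zero fun i _ => hf i fun h => i.2 (h ▸ hj)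
    · exact Fintype.sum_eq_single _ fun i hi => hf i fun h => hi (Subtype.ext h)
  rw [hzero _ fun i hi => by rw [hQ₃ i i.2, one_apply_ne hi, mul_zero]]
  split_ifs with hj
  · have h1 := congrFun hvU ⟨j, hj⟩
    rw [vecMul, dotProduct] at h1
    rw [add_zero, Finset.sum_congr rfl fun i _ => by rw [hQ₁ i i.2 j hj], h1]
    simp [one_apply, Pi.single_apply, eq_comm]
  · have h1 := congrFun hvU ⟨t, ht⟩
    rw [vecMul, dotProduct, Pi.single_eq_same] at h1
    have h2 : ∑ i : {i // T i}, v i * Q i j = -((∑ i : {i // T i}, v i * U i ⟨t, ht⟩) * v j) := by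
      rw [Finset.sum_mul, ← Finset.sum_neg_distrib]
      exact Finset.sum_congr rfl fun i _ => by rw [hQ₂ i i.2 j hj]; ring
    rw [h2, h1, hQ₃ j hj, one_apply_eq, one_apply_ne (by rintro rfl; exact hj ht)]
    ring

/-- If the first `c` rows of `V`, the first `t` of which are standard, have a right inverse
supported in the first `k` rows, then they can be made standard by an invertible matrix which is
trivial in the first `t` rows and in the rows from `k` on. -/
theorem exists_mul_rows_eq_one {c k : ℕ} (hck : c ≤ k) (t : ℕ)
    {V X : Matrix (Fin l) (Fin l) (MvPolynomial (Fin n) K)}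
    (hV : ∀ i : Fin l, (i : ℕ) < t → V i = (1 : Matrix (Fin l) (Fin l) _) i)
    (hX : ∀ i : Fin l, k ≤ i → X i = 0)
    (hVX : ∀ i j : Fin l, (i : ℕ) < c → (j : ℕ) < c →
      (V * X) i j = (1 : Matrix (Fin l) (Fin l) _) i j) :
    ∃ Q : Matrix (Fin l) (Fin l) (MvPolynomial (Fin n) K), IsUnit Q.det ∧
      (∀ i : Fin l, (i : ℕ) < t ∨ k ≤ i → Q i = (1 : Matrix (Fin l) (Fin l) _) i) ∧
      ∀ i : Fin l, (i : ℕ) < c → (V * Q) i = (1 : Matrix (Fin l) (Fin l) _) i := by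
  induction hm : c - t generalizing t V X with
  | zero =>
    exact ⟨1, by simp, fun _ _ => rfl, fun i hi => by rw [mul_one]; exact hV i (by omega)⟩
  | succ m ih =>
    by_cases htl : l ≤ t
    · exact ⟨1, by simp, fun _ _ => rfl, fun i hi => by rw [mul_one]; exact hV i (by omega)⟩
    push Not at htl
    obtain ⟨Q₁, hQ₁, hrow, hclear⟩ := exists_vecMul_eq_single
      (fun j : Fin l => t ≤ j ∧ (j : ℕ) < k) (t := ⟨t, htl⟩) ⟨le_rfl, by simp only; omega⟩
      (v := V ⟨t, htl⟩) (w := fun j => X j ⟨t, htl⟩)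
      (by
        rw [← mul_apply, hVX _ _ (by simp only; omega) (by simp only; omega), one_apply_eq])
      (by
        intro j hj
        by_cases hjt : (j : ℕ) < t
        · have := mul_row_of_row_eq_one (hV j hjt) X
          rw [← this, hVX _ _ (by omega) (by simp only; omega),
            one_apply_ne]
          exact fun h => by simp [h] at hjt
        · rw [hX j (by omega), Pi.zero_apply])
    obtain ⟨Q₂, hQ₂, hrow₂, hfin⟩ := ih (t + 1) (V := V * Q₁) (X := Q₁⁻¹ * X)
      (by
        intro i hi
        by_cases hit : (i : ℕ) < t
        · rw [mul_row_of_row_eq_one (hV i hit), hrow i (by omega)]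
        · obtain rfl : i = ⟨t, htl⟩ := Fin.ext (by simp only; omega)
          rw [mul_apply_eq_vecMul, hclear])
      (by
        intro i hi
        rw [mul_row_of_row_eq_one (inv_row_eq_one hQ₁ (hrow i (by omega))), hX i hi])
      (by
        intro i j hi hj
        rw [Matrix.mul_assoc, mul_nonsing_inv_cancel_left _ _ hQ₁, hVX i j hi hj])
      (by omega)
    refine ⟨Q₁ * Q₂, by rw [det_mul]; exact hQ₁.mul hQ₂, fun i hi => ?_, fun i hi => ?_⟩
    · rw [mul_row_of_row_eq_one (hrow i (by omega)), hrow₂ i (by omega)]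
    · rw [← Matrix.mul_assoc, hfin i hi]

/-- If the first `c` rows of `V` are standard modulo `y`, then their entries above the diagonal can
be made divisible by any power of `y`, without touching the first `b` rows. -/
theorem exists_pow_dvd_mul_apply {b c : ℕ} {y : R} {V : Matrix (Fin l) (Fin l) R}
    (hb : ∀ i : Fin l, (i : ℕ) < b → V i = (1 : Matrix (Fin l) (Fin l) R) i)
    (hc : ∀ i j : Fin l, (i : ℕ) < c → y ∣ V i j - (1 : Matrix (Fin l) (Fin l) R) i j) (N : ℕ) :
    ∃ Q : Matrix (Fin l) (Fin l) R, IsUnit Q.det ∧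
      (∀ i : Fin l, (i : ℕ) < b ∨ c ≤ i → Q i = (1 : Matrix (Fin l) (Fin l) R) i) ∧
      (∀ i j : Fin l, (i : ℕ) < c → y ∣ (V * Q) i j - (1 : Matrix (Fin l) (Fin l) R) i j) ∧
      ∀ i j : Fin l, (i : ℕ) < c → i < j → y ^ (N + 1) ∣ (V * Q) i j := by
  induction N with
  | zero =>
    refine ⟨1, by simp, fun _ _ => rfl, by simpa using hc, fun i j hi hij => ?_⟩
    simpa [one_apply_ne hij.ne] using hc i j hi
  | succ N ih =>
    obtain ⟨Q, hQ, hrow, hdvd, hpow⟩ := ih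
    choose! z hz using hpow
    let Z : Matrix (Fin l) (Fin l) R :=
      Matrix.of fun i j => if b ≤ i ∧ (i : ℕ) < c ∧ i < j then -z i j else 0
    let U : Matrix (Fin l) (Fin l) R := 1 + y ^ (N + 1) • Z
    have hU : U.det = 1 := by
      rw [det_of_isUpperTriangular]
      · simp [U, Z]
      · intro i j hij
        have hij : j < i := hij
        simp [U, Z, one_apply_ne hij.ne', hij.le.not_gt]
    have hUrow : ∀ i : Fin l, (i : ℕ) < b ∨ c ≤ i → U i = (1 : Matrix (Fin l) (Fin l) R) i := by
      intro i hi
      ext1 j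
      have : ¬ (b ≤ i ∧ (i : ℕ) < c ∧ i < j) := by omega
      simp [U, Z, this]
    have hW : V * (Q * U) = V * Q + y ^ (N + 1) • (V * Q * Z) := by
      simp [U, Matrix.mul_add, Matrix.mul_assoc]
    refine ⟨Q * U, by rw [det_mul, hU, mul_one]; exact hQ, fun i hi => ?_, fun i j hi => ?_,
      fun i j hi hij => ?_⟩
    · rw [mul_row_of_row_eq_one (hrow i hi), hUrow i hi]
    · rw [hW, Matrix.add_apply, add_sub_right_comm, Matrix.smul_apply, smul_eq_mul,
        pow_succ', mul_assoc]
      exact dvd_add (hdvd i j hi) (Dvd.intro _ rfl)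
    · by_cases hib : (i : ℕ) < b
      · rw [mul_row_of_row_eq_one (hb i hib), mul_row_of_row_eq_one (hrow i (.inl hib)),
          hUrow i (.inl hib), one_apply_ne hij.ne]
        exact dvd_zero _
      · have hZ : (V * Q * Z) i j =
            -z i j + ∑ m, ((V * Q) i m - (1 : Matrix _ _ R) i m) * Z m j := by
          have h1 : Z i j = -z i j := by
            have : b ≤ i ∧ (i : ℕ) < c ∧ i < j := ⟨by omega, hi, hij⟩
            simp [Z, this]
          rw [← h1, mul_apply]
          simp [sub_mul, one_apply]
        rw [hW, Matrix.add_apply, Matrix.smul_apply, smul_eq_mul, hz i j hi hij, hZ, ← mul_add,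
          add_neg_cancel_left, pow_succ]
        exact mul_dvd_mul_left _ (Finset.dvd_sum fun m _ => (hdvd i m hi).mul_right _)

end MatrixRows

section Minors

variable {R S : Type*} [CommRing R] [CommRing S] {l : ℕ}

/-- Scaling the trailing columns commutes with equivalence, as soon as the left diagonal factor
can be moved across the transformed matrix. -/
theorem matEquiv_diagonal_mul_mul_diagonal [IsDomain R] {k : ℕ} {d : Fin l → R}
    (hd : ∀ j, d j ≠ 0) (x : R) (hx : x ≠ 0) {V Q : Matrix (Fin l) (Fin l) R}
    (hV : IsUnit V.det) (hQ : IsUnit Q.det)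
    (hrow : ∀ i : Fin l, k ≤ i → Q i = (1 : Matrix (Fin l) (Fin l) R) i)
    (hdvd : ∀ i j, d j ∣ d i * (V * Q) i j) :
    MatEquiv (diagonal d * V * diagonal fun j : Fin l => if (j : ℕ) < k then 1 else x)
      (diagonal d * diagonal fun j : Fin l => if (j : ℕ) < k then 1 else x) := by
  choose P hP using hdvd
  set e : Fin l → R := fun j => if (j : ℕ) < k then 1 else x
  have hP' : of P * diagonal d = diagonal d * (V * Q) := by
    ext i j
    rw [mul_diagonal, diagonal_mul, hP, of_apply, mul_comm]
  have hPdet : (of P).det = (V * Q).det := by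
    have := congrArg det hP'
    rw [det_mul, det_mul, mul_comm, det_diagonal] at this
    exact mul_left_cancel₀ (Finset.prod_ne_zero_iff.2 fun j _ => hd j) this
  have hPunit : IsUnit (of P).det := by
    rw [hPdet, det_mul]
    exact hV.mul hQ
  let N : Matrix (Fin l) (Fin l) R :=
    of fun i j => if (i : ℕ) < k then Q i j * e j else (1 : Matrix (Fin l) (Fin l) R) i j
  have hN : diagonal e * N = Q * diagonal e := by
    ext i j
    rw [mul_diagonal, diagonal_mul]
    by_cases hi : (i : ℕ) < k
    · simp [N, e, hi]
    · rw [hrow i (by omega)]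
      by_cases hij : i = j
      · subst hij
        simp [N, e, hi]
      · simp [N, hi, hij]
  have hNdet : N.det = Q.det := by
    have := congrArg det hN
    rw [det_mul, det_mul, mul_comm Q.det, det_diagonal] at this
    refine mul_left_cancel₀ (Finset.prod_ne_zero_iff.2 fun j _ => ?_) this
    simp only [e]
    split_ifs
    exacts [one_ne_zero, hx]
  refine ⟨(of P)⁻¹, N, isUnit_nonsing_inv_det _ hPunit, hNdet ▸ hQ, ?_⟩
  calc diagonal d * diagonal e = (of P)⁻¹ * (of P * diagonal d) * diagonal e := by
        rw [nonsing_inv_mul_cancel_left _ _ hPunit]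
    _ = _ := by
        rw [hP']
        simp only [Matrix.mul_assoc, hN]

/-- If the minors of `V` in the first `c` rows and first `k` columns generate the unit ideal, then
the first `c` rows have a right inverse supported in the first `k` rows. -/
theorem exists_right_inverse_of_span_minors {c k : ℕ} {V : Matrix (Fin l) (Fin l) R}
    (h : Ideal.span {p : R | ∃ ri ci : Fin c → Fin l, Function.Injective ri ∧
      (∀ a, (ri a : ℕ) < c) ∧ (∀ a, (ci a : ℕ) < k) ∧ p = (V.submatrix ri ci).det} = ⊤) :
    ∃ X : Matrix (Fin l) (Fin l) R, (∀ i : Fin l, k ≤ i → X i = 0) ∧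
      ∀ i j : Fin l, (i : ℕ) < c → (j : ℕ) < c →
        (V * X) i j = (1 : Matrix (Fin l) (Fin l) R) i j := by
  suffices H : ∀ p : R, ∃ X : Matrix (Fin l) (Fin l) R, (∀ i : Fin l, k ≤ i → X i = 0) ∧
      ∀ i j : Fin l, (i : ℕ) < c → (V * X) i j = p * (1 : Matrix (Fin l) (Fin l) R) i j by
    obtain ⟨X, hX, hVX⟩ := H 1
    exact ⟨X, hX, fun i j hi _ => by rw [hVX i j hi, one_mul]⟩
  intro p
  have hp : p ∈ (⊤ : Ideal R) := Submodule.mem_top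
  rw [← h] at hp
  induction hp using Submodule.span_induction with
  | mem p hp =>
    obtain ⟨ri, ci, hinj, hri, hci, rfl⟩ := hp
    have hsurj : Function.Surjective fun a => (⟨ri a, hri a⟩ : Fin c) :=
      Finite.injective_iff_surjective.1 fun a b hab => hinj (Fin.ext (by simpa using hab))
    let E : Matrix (Fin l) (Fin c) R := (1 : Matrix (Fin l) (Fin l) R).submatrix id ci
    let W : Matrix (Fin c) (Fin l) R :=
      (V.submatrix ri ci).adjugate * (1 : Matrix (Fin l) (Fin l) R).submatrix ri id
    refine ⟨E * W, fun i hi => ?_, fun i j hi => ?_⟩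
    · have : E i = 0 := by
        ext1 a
        exact one_apply_ne fun h => by have := hci a; simp only [id] at h; omega
      rw [mul_apply_eq_vecMul, this, zero_vecMul]
    · obtain ⟨a, ha⟩ := hsurj ⟨i, hi⟩
      obtain rfl : ri a = i := Fin.ext (by simpa using ha)
      have h1 : (V * E).submatrix ri id = V.submatrix ri ci := by
        ext
        rw [submatrix_apply, mul_apply]
        simp [E, one_apply]
      calc (V * (E * W)) (ri a) j = ((V * E).submatrix ri id * W) a j := by
            rw [← Matrix.mul_assoc]
            rfl
        _ = _ := by
            rw [h1, ← Matrix.mul_assoc, mul_adjugate, Matrix.smul_mul, Matrix.one_mul]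
            rfl
  | zero => exact ⟨0, fun _ _ => rfl, by simp⟩
  | add p q _ _ hp hq =>
    obtain ⟨X, hX, hVX⟩ := hp
    obtain ⟨Y, hY, hVY⟩ := hq
    refine ⟨X + Y, fun i hi => ?_, fun i j hi => ?_⟩
    · change X i + Y i = 0
      rw [hX i hi, hY i hi, add_zero]
    · rw [Matrix.mul_add, Matrix.add_apply, hVX i j hi, hVY i j hi, add_mul]
  | smul a p _ hp =>
    obtain ⟨X, hX, hVX⟩ := hp
    refine ⟨a • X, fun i hi => ?_, fun i j hi => ?_⟩
    · change a • X i = 0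
      rw [hX i hi, smul_zero]
    · rw [Matrix.mul_smul, Matrix.smul_apply, hVX i j hi, smul_eq_mul, smul_eq_mul, mul_assoc]

theorem sum_range_add_mul_card_sdiff_le {f : ℕ → ℕ} {c M ε : ℕ} (h₁ : ∀ i < c, f i ≤ M)
    (h₂ : ∀ j, c ≤ j → M + ε ≤ f j) {T : Finset ℕ} (hT : T.card = c) :
    ∑ i ∈ Finset.range c, f i + ε * (T \ Finset.range c).card ≤ ∑ i ∈ T, f i := by
  have hcard : (Finset.range c \ T).card = (T \ Finset.range c).card :=
    Finset.card_sdiff_comm (by rw [hT, Finset.card_range])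
  have e₁ := Finset.sum_inter_add_sum_sdiff (Finset.range c) T f
  have e₂ := Finset.sum_inter_add_sum_sdiff T (Finset.range c) f
  rw [Finset.inter_comm] at e₂
  have l₁ : ∑ i ∈ Finset.range c \ T, f i ≤ (Finset.range c \ T).card • M :=
    Finset.sum_le_card_nsmul _ _ _ fun i hi => h₁ i (by simp at hi; exact hi.1)
  have l₂ : (T \ Finset.range c).card • (M + ε) ≤ ∑ i ∈ T \ Finset.range c, f i :=
    Finset.card_nsmul_le_sum _ _ _ fun i hi => h₂ i (by simp at hi; exact hi.2)
  rw [hcard] at l₁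
  simp only [smul_eq_mul] at l₁ l₂
  linarith

/-- Any `c` distinct values of a monotone sequence sum up to at least the sum of its first `c`
values. -/
theorem Monotone.sum_range_le_sum_comp {f : ℕ → ℕ} (hf : Monotone f) {c : ℕ} {g : Fin c → ℕ}
    (hg : Function.Injective g) : ∑ i ∈ Finset.range c, f i ≤ ∑ a, f (g a) := by
  have := sum_range_add_mul_card_sdiff_le (f := f) (M := f (c - 1)) (ε := 0) (c := c)
    (fun i hi => hf (by omega)) (fun j hj => hf (by omega)) (T := Finset.univ.image g)
    (by rw [Finset.card_image_of_injective _ hg, Finset.card_fin])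
  rwa [zero_mul, add_zero, Finset.sum_image fun a _ b _ h => hg h] at this

theorem Monotone.sum_range_lt_sum_comp {f : ℕ → ℕ} (hf : Monotone f) {c : ℕ} {g : Fin c → ℕ}
    (hg : Function.Injective g) (hlt : ∀ i < c, ∀ j, c ≤ j → f i < f j) {a : Fin c}
    (ha : c ≤ g a) : ∑ i ∈ Finset.range c, f i < ∑ a, f (g a) := by
  have := sum_range_add_mul_card_sdiff_le (f := f) (M := f (c - 1)) (ε := 1) (c := c)
    (fun i hi => hf (by omega)) (fun j hj => hlt _ (by have := a.2; omega) j hj)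
    (T := Finset.univ.image g)
    (by rw [Finset.card_image_of_injective _ hg, Finset.card_fin])
  have hpos : 0 < (Finset.univ.image g \ Finset.range c).card :=
    Finset.card_pos.2 ⟨g a, by simpa using ha⟩
  rw [one_mul, Finset.sum_image fun a _ b _ h => hg h] at this
  omega

theorem span_minors_map_eq_top [IsDomain R] {c k : ℕ} {x y : R} (hx : x ≠ 0) (hy : y ≠ 0)
    {r s : ℕ → ℕ} (hr : Monotone r) (hs : Monotone s) {V B : Matrix (Fin l) (Fin l) R}
    (hB : B = (diagonal fun j : Fin l => x ^ r j * y ^ s j) * V *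
      diagonal fun j : Fin l => if (j : ℕ) < k then 1 else x)
    (φ : R →+* S) (hφx : φ x = 0)
    (hφ : (∀ i < c, ∀ j, c ≤ j → r i < r j) ∨ φ y = 0 ∧ ∀ i < c, ∀ j, c ≤ j → s i < s j)
    (hJ : JEqTop c B)
    (hd : ∀ d, IsGcdMinors c B d → Associated d
      (x ^ (∑ j ∈ Finset.range c, r j) * y ^ (∑ j ∈ Finset.range c, s j))) :
    Ideal.span {p : S | ∃ ri ci : Fin c → Fin l, Function.Injective ri ∧
      (∀ a, (ri a : ℕ) < c) ∧ (∀ a, (ci a : ℕ) < k) ∧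
        p = ((V.map φ).submatrix ri ci).det} = ⊤ := by
  obtain ⟨d, hgcd, htop⟩ := hJ
  obtain ⟨u, hu⟩ := hd d hgcd
  have hd0 : d ≠ 0 := by
    rintro rfl
    rw [zero_mul] at hu
    exact mul_ne_zero (pow_ne_zero _ hx) (pow_ne_zero _ hy) hu.symm
  rw [eq_top_iff, ← Ideal.map_top φ, ← htop, Ideal.map_span, Ideal.span_le]
  rintro _ ⟨b, ⟨ri, ci, hri, hci, hb⟩, rfl⟩
  have hsub : B.submatrix ri ci = (diagonal fun a => x ^ r (ri a) * y ^ s (ri a)) *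
      V.submatrix ri ci * diagonal fun a => if (ci a : ℕ) < k then 1 else x := by
    ext i j
    simp [hB, mul_diagonal, diagonal_mul]
  have hri' : Function.Injective fun a => (ri a : ℕ) := Fin.val_injective.comp hri
  obtain ⟨ρ, hρ⟩ := Nat.exists_eq_add_of_le (hr.sum_range_le_sum_comp hri')
  obtain ⟨τ, hτ⟩ := Nat.exists_eq_add_of_le (hs.sum_range_le_sum_comp hri')
  have hb' : b = u * x ^ ρ * y ^ τ * (V.submatrix ri ci).det *
      ∏ a, if (ci a : ℕ) < k then 1 else x := by
    apply mul_left_cancel₀ hd0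
    rw [hb, hsub, det_mul, det_mul, det_diagonal, det_diagonal, Finset.prod_mul_distrib,
      Finset.prod_pow_eq_pow_sum, Finset.prod_pow_eq_pow_sum, hρ, hτ, pow_add, pow_add]
    linear_combination -(x ^ ρ * y ^ τ * (V.submatrix ri ci).det *
      ∏ a, if (ci a : ℕ) < k then 1 else x) * hu
  rw [SetLike.mem_coe]
  by_cases h₁ : ∀ a, (ci a : ℕ) < k
  · by_cases h₂ : ∀ a, (ri a : ℕ) < c
    · rw [hb', map_mul, map_mul, RingHom.map_det, mul_right_comm]
      exact Ideal.mul_mem_left _ _ (Ideal.subset_span ⟨ri, ci, hri, h₂, h₁, rfl⟩)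
    · push Not at h₂
      obtain ⟨a, ha⟩ := h₂
      have : φ b = 0 := by
        rcases hφ with hφ | ⟨hφy, hφ⟩
        · have := hr.sum_range_lt_sum_comp hri' hφ ha
          simp [hb', hφx, show ρ ≠ 0 by omega]
        · have := hs.sum_range_lt_sum_comp hri' hφ ha
          simp [hb', hφy, show τ ≠ 0 by omega]
      rw [this]
      exact zero_mem _
  · push Not at h₁
    obtain ⟨a, ha⟩ := h₁
    have : ∏ a, φ (if (ci a : ℕ) < k then 1 else x) = 0 :=
      Finset.prod_eq_zero (Finset.mem_univ a) (by rw [if_neg (by omega), hφx])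
    rw [hb', map_mul, map_prod, this, mul_zero]
    exact zero_mem _

theorem Monotone.exists_forall_lt_forall_eq {f : ℕ → ℕ} (hf : Monotone f) {k M : ℕ}
    (hM : ∀ j, k ≤ j → f j = M) :
    ∃ b ≤ k, (∀ i < b, ∀ j, b ≤ j → f i < f j) ∧ ∀ j, b ≤ j → f j = M := by
  have hle : ∀ j, f j ≤ M := fun j =>
    (hf (le_max_left j k)).trans_eq (hM _ (le_max_right j k))
  have hex : ∃ b, f b = M := ⟨k, hM k le_rfl⟩
  have heq : ∀ j, Nat.find hex ≤ j → f j = M := fun j hj =>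
    (hle j).antisymm ((Nat.find_spec hex).symm.trans_le (hf hj))
  refine ⟨Nat.find hex, Nat.find_min' hex (hM k le_rfl), fun i hi j hj => ?_, heq⟩
  rw [heq j hj]
  exact (hle i).lt_of_ne (Nat.find_min hex hi)

end Minors

section MvPolynomial

variable {K : Type*} [Field K] {n l : ℕ}

/-- Given right inverses for the first `b` rows of `V`, and for its first `c` rows modulo `y`,
there is an invertible matrix making the first `b` rows standard and the entries above the diagonal
in the first `c` rows divisible by an arbitrary power of `y`. -/
theorem exists_mul_rows_eq_one_and_dvd {b c k : ℕ} (hb : b ≤ k) (hc : c ≤ k)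
    {y : MvPolynomial (Fin n) K} (σ : MvPolynomial (Fin n) K →+* MvPolynomial (Fin n) K)
    (hσ : ∀ p, y ∣ p - σ p) {V X Y : Matrix (Fin l) (Fin l) (MvPolynomial (Fin n) K)}
    (hX : ∀ i : Fin l, k ≤ i → X i = 0)
    (hVX : ∀ i j : Fin l, (i : ℕ) < b → (j : ℕ) < b →
      (V * X) i j = (1 : Matrix (Fin l) (Fin l) _) i j)
    (hY : ∀ i : Fin l, k ≤ i → Y i = 0)
    (hVY : ∀ i j : Fin l, (i : ℕ) < c → (j : ℕ) < c →
      (V.map σ * Y) i j = (1 : Matrix (Fin l) (Fin l) _) i j) (N : ℕ) :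
    ∃ Q : Matrix (Fin l) (Fin l) (MvPolynomial (Fin n) K), IsUnit Q.det ∧
      (∀ i : Fin l, k ≤ i → Q i = (1 : Matrix (Fin l) (Fin l) _) i) ∧
      (∀ i : Fin l, (i : ℕ) < b → (V * Q) i = (1 : Matrix (Fin l) (Fin l) _) i) ∧
      ∀ i j : Fin l, (i : ℕ) < c → i < j → y ^ (N + 1) ∣ (V * Q) i j := by
  obtain ⟨Q₁, hQ₁, hrow₁, hstd₁⟩ := exists_mul_rows_eq_one hb 0 (by simp) hX hVX
  have hmap : ∀ {A : Matrix (Fin l) (Fin l) (MvPolynomial (Fin n) K)} {i : Fin l},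
      A i = (1 : Matrix (Fin l) (Fin l) _) i →
        A.map σ i = (1 : Matrix (Fin l) (Fin l) _) i := fun {A i} h => by
    rw [← Matrix.map_one σ (map_zero σ) (map_one σ)]
    ext1 j
    rw [map_apply, map_apply, h]
  have hQσ : IsUnit (Q₁.map σ).det := by
    rw [← RingHom.mapMatrix_apply, ← RingHom.map_det]
    exact hQ₁.map σ
  obtain ⟨Q₂, hQ₂, hrow₂, hstd₂⟩ := exists_mul_rows_eq_one (V := (V * Q₁).map σ)
    (X := (Q₁.map σ)⁻¹ * Y) hc b (fun i hi => hmap (hstd₁ i hi))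
    (fun i hi => by
      rw [mul_row_of_row_eq_one (inv_row_eq_one hQσ (hmap (hrow₁ i (.inr hi)))), hY i hi])
    (fun i j hi hj => by
      rw [Matrix.map_mul, Matrix.mul_assoc, mul_nonsing_inv_cancel_left _ _ hQσ, hVY i j hi hj])
  have hstd : ∀ i : Fin l, (i : ℕ) < b →
      (V * Q₁ * Q₂) i = (1 : Matrix (Fin l) (Fin l) _) i := fun i hi => by
    rw [mul_row_of_row_eq_one (hstd₁ i hi), hrow₂ i (.inl hi)]
  obtain ⟨Q₃, hQ₃, hrow₃, -, hdvd⟩ := exists_pow_dvd_mul_apply (y := y) (c := c) hstd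
    (fun i j hi => by
      rw [← hstd₂ i hi, ← Matrix.sub_apply, ← Matrix.sub_mul, mul_apply]
      exact Finset.dvd_sum fun m _ => (hσ _).mul_right _) N
  refine ⟨Q₁ * Q₂ * Q₃, ?_, fun i hi => ?_, fun i hi => ?_, fun i j hi hij => ?_⟩
  · rw [det_mul, det_mul]
    exact (hQ₁.mul hQ₂).mul hQ₃
  · rw [Matrix.mul_assoc, mul_row_of_row_eq_one (hrow₁ i (.inr hi)),
      mul_row_of_row_eq_one (hrow₂ i (.inr hi)), hrow₃ i (.inr (hc.trans hi))]
  · rw [← Matrix.mul_assoc, ← Matrix.mul_assoc, mul_row_of_row_eq_one (hstd i hi),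
      hrow₃ i (.inl hi)]
  · rw [← Matrix.mul_assoc, ← Matrix.mul_assoc]
    exact hdvd i j hi hij

/-- Setting the variable `v` to zero. -/
noncomputable def setVarZero (K : Type*) [Field K] {n : ℕ} (v : Fin n) :
    MvPolynomial (Fin n) K →+* MvPolynomial (Fin n) K :=
  eval₂Hom C fun i => if i = v then 0 else X i

@[simp]
theorem setVarZero_X_self (v : Fin n) : setVarZero K v (X v) = 0 := by
  simp [setVarZero]

theorem setVarZero_X_of_ne {i v : Fin n} (h : i ≠ v) : setVarZero K v (X i) = X i := by
  simp [setVarZero, h]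

theorem X_dvd_sub_setVarZero (v : Fin n) (p : MvPolynomial (Fin n) K) :
    X v ∣ p - setVarZero K v p := by
  induction p using MvPolynomial.induction_on with
  | C a => simp [setVarZero]
  | add p q hp hq =>
    rw [map_add, add_sub_add_comm]
    exact dvd_add hp hq
  | mul_X p i hp =>
    rw [map_mul]
    by_cases h : i = v
    · subst h
      simp
    · rw [setVarZero_X_of_ne h, ← sub_mul]
      exact hp.mul_right _

theorem setVarZero_of_mem_supported {v : Fin n} {p : MvPolynomial (Fin n) K}
    (hp : p ∈ supported K ({v}ᶜ : Set (Fin n))) : setVarZero K v p = p := by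
  rw [mem_supported] at hp
  refine (MvPolynomial.hom_congr_vars (f₁ := setVarZero K v)
    (f₂ := RingHom.id _) (p₁ := p) (p₂ := p) ?_ (fun i hi _ => ?_) rfl).trans rfl
  · ext a
    simp [setVarZero]
  · exact setVarZero_X_of_ne (hp hi)

end MvPolynomial

/-- Let
`B = diag(x₁^{r₁}x₂^{s₁},…,x₁^{r_k}x₂^{s_k}, x₁^{rE}x₂^{sE} I_{l-k}) * V * diag(I_k, x₁ I_{l-k})`
with `V` unimodular not involving `x₁`, `r₁ ≤ ⋯ ≤ r_k ≤ rE`, `s₁ ≤ ⋯ ≤ s_k ≤ sE`, and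
`r₁ = s₁ = 0` (neither `x₁` nor `x₂` divides `d₁(B)`).  If `J_i(B) = R` and `d_i(B)` is
associated to `x₁^{r₁+⋯+r_i} x₂^{s₁+⋯+s_i}` for `i = 1,…,k`, then `B` is equivalent to
`B₁ = diag(x₁^{r₁}x₂^{s₁},…,x₁^{r_k}x₂^{s_k}, x₁^{rE+1}x₂^{sE} I_{l-k})`. -/
theorem statement10 {K : Type*} [Field K] {n l : ℕ}
    (v1 v2 : Fin n) (hv1 : (v1 : ℕ) = 0) (hv2 : (v2 : ℕ) = 1)
    (k : ℕ) (hk1 : 1 ≤ k) (hkl : k ≤ l)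
    (V : Matrix (Fin l) (Fin l) (MvPolynomial (Fin n) K))
    (hV : IsUnit V.det)
    (hVx : ∀ a b, V a b ∈ MvPolynomial.supported K (({v1} : Set (Fin n))ᶜ))
    (r s : ℕ → ℕ) (rE sE : ℕ)
    (hrmono : ∀ i j, i ≤ j → j < k → r i ≤ r j)
    (hsmono : ∀ i j, i ≤ j → j < k → s i ≤ s j)
    (hrE : ∀ i < k, r i ≤ rE) (hsE : ∀ i < k, s i ≤ sE)
    (hr0 : r 0 = 0) (hs0 : s 0 = 0)
    (B : Matrix (Fin l) (Fin l) (MvPolynomial (Fin n) K))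
    (hB : B =
      Matrix.diagonal (fun j : Fin l => if (j : ℕ) < k
        then X v1 ^ r (j : ℕ) * X v2 ^ s (j : ℕ) else X v1 ^ rE * X v2 ^ sE) * V *
        Matrix.diagonal (fun j : Fin l => if (j : ℕ) < k then 1 else X v1))
    (hJ : ∀ i, 1 ≤ i → i ≤ k → JEqTop i B)
    (hd : ∀ i, 1 ≤ i → i ≤ k → ∀ d, IsGcdMinors i B d →
      Associated d
        (X v1 ^ (∑ j ∈ Finset.range i, r j) * X v2 ^ (∑ j ∈ Finset.range i, s j))) :
    MatEquiv B
      (Matrix.diagonal (fun j : Fin l => if (j : ℕ) < k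
        then X v1 ^ r (j : ℕ) * X v2 ^ s (j : ℕ) else X v1 ^ (rE + 1) * X v2 ^ sE)) := by

  set x : MvPolynomial (Fin n) K := X v1
  set y : MvPolynomial (Fin n) K := X v2
  have hv : v2 ≠ v1 := fun h => by rw [h, hv1] at hv2; omega
  have hx : x ≠ 0 := X_ne_zero v1
  have hy : y ≠ 0 := X_ne_zero v2
  let r' : ℕ → ℕ := fun j => if j < k then r j else rE
  let s' : ℕ → ℕ := fun j => if j < k then s j else sE
  have hmono : ∀ {f : ℕ → ℕ} {M : ℕ}, (∀ i j, i ≤ j → j < k → f i ≤ f j) →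
      (∀ i < k, f i ≤ M) → Monotone fun j => if j < k then f j else M := by
    intro f M hf hM i j hij
    dsimp only
    split_ifs with hi hj
    exacts [hf i j hij hj, hM i hi, by omega, le_rfl]
  have hr' : Monotone r' := hmono hrmono hrE
  have hs' : Monotone s' := hmono hsmono hsE
  have hrk : ∀ j, k ≤ j → r' j = rE := fun j hj => if_neg hj.not_gt
  have hsk : ∀ j, k ≤ j → s' j = sE := fun j hj => if_neg hj.not_gt
  obtain ⟨b, hbk, hb, hbE⟩ := hr'.exists_forall_lt_forall_eq hrk
  obtain ⟨c, hck, hc, hcE⟩ := hs'.exists_forall_lt_forall_eq hsk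
  have hdiag : (diagonal fun j : Fin l => if (j : ℕ) < k
      then x ^ r (j : ℕ) * y ^ s (j : ℕ) else x ^ rE * y ^ sE) =
      diagonal fun j : Fin l => x ^ r' j * y ^ s' j := by
    congr 1
    ext1 j
    simp only [r', s']
    split_ifs <;> rfl
  rw [hdiag] at hB
  have hinv : ∀ m ≤ k, ∀ φ : MvPolynomial (Fin n) K →+* MvPolynomial (Fin n) K, φ x = 0 →
      ((∀ i < m, ∀ j, m ≤ j → r' i < r' j) ∨ φ y = 0 ∧ ∀ i < m, ∀ j, m ≤ j → s' i < s' j) →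
      ∃ Y : Matrix (Fin l) (Fin l) (MvPolynomial (Fin n) K), (∀ i : Fin l, k ≤ i → Y i = 0) ∧
        ∀ i j : Fin l, (i : ℕ) < m → (j : ℕ) < m →
          (V.map φ * Y) i j = (1 : Matrix (Fin l) (Fin l) _) i j := by
    intro m hmk φ hφx hφ
    rcases Nat.eq_zero_or_pos m with rfl | hm
    · exact ⟨0, fun _ _ => rfl, fun i _ hi => absurd hi (Nat.not_lt_zero _)⟩
    refine exists_right_inverse_of_span_minors
      (span_minors_map_eq_top hx hy hr' hs' hB φ hφx hφ (hJ m hm hmk) fun d hdm => ?_)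
    convert hd m hm hmk d hdm using 4 with j hj j hj
    · exact if_pos ((Finset.mem_range.1 hj).trans_le hmk)
    · exact if_pos ((Finset.mem_range.1 hj).trans_le hmk)
  have hV1 : V.map (setVarZero K v1) = V := by
    ext1 i j
    exact setVarZero_of_mem_supported (hVx i j)
  obtain ⟨Y₁, hY₁, hVY₁⟩ := hinv b hbk (setVarZero K v1) (setVarZero_X_self v1) (.inl hb)
  obtain ⟨Y₂, hY₂, hVY₂⟩ := hinv c hck
    ((setVarZero K v2).comp (setVarZero K v1))
    (by simp [x]) (.inr ⟨by simp [y, setVarZero_X_of_ne hv], hc⟩)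
  rw [hV1] at hVY₁
  rw [RingHom.coe_comp, ← Matrix.map_map, hV1] at hVY₂
  obtain ⟨Q, hQ, hrow, hstd, hdvd⟩ := exists_mul_rows_eq_one_and_dvd hbk hck
    (setVarZero K v2) (X_dvd_sub_setVarZero v2)
    hY₁ hVY₁ hY₂ hVY₂ sE
  have hs_le : ∀ j, s' j ≤ sE := fun j =>
    (hs' (le_max_left j k)).trans_eq (hsk _ (le_max_right j k))
  have key := matEquiv_diagonal_mul_mul_diagonal (d := fun j : Fin l => x ^ r' j * y ^ s' j)
    (fun j => mul_ne_zero (pow_ne_zero _ hx) (pow_ne_zero _ hy)) x hx hV hQ hrow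
    (fun i j => by
      rcases le_or_gt j i with hji | hij
      · exact (mul_dvd_mul (pow_dvd_pow _ (hr' hji)) (pow_dvd_pow _ (hs' hji))).mul_right _
      · by_cases hib : (i : ℕ) < b
        · rw [hstd i hib, one_apply_ne hij.ne, mul_zero]
          exact dvd_zero _
        · have hij' : (i : ℕ) < j := hij
          rw [hbE i (by omega), hbE j (by omega), mul_assoc]
          refine mul_dvd_mul_left _ ?_
          by_cases hic : (i : ℕ) < c
          · exact ((pow_dvd_pow _ ((hs_le j).trans sE.le_succ)).trans
              (hdvd i j hic hij)).mul_left _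
          · rw [hcE i (by omega), hcE j (by omega)]
            exact Dvd.intro _ rfl)
  rw [← hB, diagonal_mul_diagonal] at key
  convert key using 2
  ext1 j
  simp only [r', s']
  split_ifs
  · rw [mul_one]
  · ring
end

section
/- Let B = diag(x_1^{r_1}x_2^{s_1},..., x_1^{r_t}x_2^{s_t}, x_1^{r}x_2^{s} I_{l−t}) · U · diag(I_t, x_2 I_{l−t}), where U ∈ R^{l×l} is a unimodular matrix whose entries lie in K[x_1,x_3,...,x_n] (not involving x_2), r_1 ≤ r_2 ≤ ... ≤ r_t ≤ r, s_1 ≤ s_2 ≤ ... ≤ s_t ≤ s, and neither x_1 nor x_2 divides d_1(B) (i.e., r_1 = s_1 = 0). If J_i(B) = R and d_i(B) is associated to x_1^{r_1+...+r_i} x_2^{s_1+...+s_i} for i = 1,2,...,t, then B is equivalent to B_1 = diag(x_1^{r_1}x_2^{s_1},..., x_1^{r_t}x_2^{s_t}, x_1^{r}x_2^{s+1} I_{l−t}). -/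
open Matrix MvPolynomial

/-- Two vectors are equivalent if an invertible matrix maps one to the other. -/
def VecEquiv {A ι : Type*} [CommRing A] [Fintype ι] [DecidableEq ι] (f g : ι → A) : Prop :=
  ∃ M : Matrix ι ι A, IsUnit M.det ∧ M *ᵥ f = g

namespace VecEquiv

variable {A ι κ : Type*} [CommRing A] [Fintype ι] [DecidableEq ι] [Fintype κ] [DecidableEq κ]

theorem refl (f : ι → A) : VecEquiv f f := ⟨1, by simp, by simp⟩

theorem trans {f g h : ι → A} : VecEquiv f g → VecEquiv g h → VecEquiv f h := by
  rintro ⟨M, hM, rfl⟩ ⟨N, hN, rfl⟩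
  exact ⟨N * M, by simpa using hN.mul hM, by simp⟩

theorem symm {f g : ι → A} : VecEquiv f g → VecEquiv g f := by
  rintro ⟨M, hM, rfl⟩
  exact ⟨M⁻¹, by simpa using hM, by simp [Matrix.nonsing_inv_mul _ hM]⟩

theorem comp_equiv {f g : ι → A} (e : κ ≃ ι) (h : VecEquiv f g) :
    VecEquiv (f ∘ e) (g ∘ e) := by
  obtain ⟨M, hM, rfl⟩ := h
  refine ⟨M.submatrix e e, by simpa using hM, ?_⟩
  rw [Matrix.submatrix_mulVec_equiv]
  simp [Function.comp_assoc]

theorem perm (f : ι → A) (σ : Equiv.Perm ι) : VecEquiv f (f ∘ σ) := by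
  refine ⟨(1 : Matrix ι ι A).submatrix σ id, ?_, ?_⟩
  · rw [Matrix.det_permute]
    simpa using (Equiv.Perm.sign σ).isUnit.map (Int.castRingHom A)
  · ext i
    simp [Matrix.mulVec, dotProduct, Matrix.one_apply]

theorem map {B : Type*} [CommRing B] (φ : A →+* B) {f g : ι → A} (h : VecEquiv f g) :
    VecEquiv (φ ∘ f) (φ ∘ g) := by
  obtain ⟨M, hM, rfl⟩ := h
  refine ⟨φ.mapMatrix M, ?_, ?_⟩
  · rw [← RingHom.map_det]; exact hM.map φ
  · ext i
    simp [RingHom.map_mulVec]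

theorem single_of_isUnit (f : ι → A) (i : ι) (hi : IsUnit (f i)) :
    VecEquiv f (Pi.single i 1) := by
  obtain ⟨u, hu⟩ := hi
  refine ⟨(1 : Matrix ι ι A).updateCol i
    (fun a => if a = i then (↑u⁻¹ : A) else - f a * (↑u⁻¹ : A)), ?_, ?_⟩
  · rw [← Matrix.cramer_apply, Matrix.cramer_one]
    simp
  · ext a
    simp only [Matrix.mulVec, dotProduct, Matrix.updateCol_apply]
    rw [← Finset.add_sum_erase _ _ (Finset.mem_univ i)]
    rw [Finset.sum_congr rfl (g := fun b => if a = b then f b else 0)]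
    · by_cases h : a = i
      · subst h
        simp [← hu, Finset.sum_ite_eq]
      · simp [h, ← hu, Finset.sum_ite_eq]
    · intro b hb
      simp [(Finset.mem_erase.mp hb).1, Matrix.one_apply]

theorem single_single (i j : ι) : VecEquiv (Pi.single i (1 : A)) (Pi.single j 1) := by
  convert perm (Pi.single i (1 : A)) (Equiv.swap i j) using 1
  ext k
  simp only [Function.comp, Pi.single_apply, Equiv.swap_apply_eq_iff, Equiv.swap_apply_left]

end VecEquiv

theorem Polynomial.vecEquiv_comp_of_sub_dvd {A κ : Type*} [CommRing A] [IsDomain A] [Fintype κ]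
    [DecidableEq κ]
    (f : Fin 2 ⊕ κ → Polynomial A) (h₁ h₂ : Polynomial A) (c : A) (hc : c ≠ 0)
    (hf : f (.inl 0) * h₁ + f (.inl 1) * h₂ = Polynomial.C c) (b b' : Polynomial A)
    (hb : Polynomial.C c ∣ b' - b) :
    VecEquiv (fun i => (f i).comp b) (fun i => (f i).comp b') := by
  have key : ∀ p : Polynomial A, ∃ q, p.comp b' = p.comp b + Polynomial.C c * q := by
    intro p
    have h1 : b' - b ∣ p.comp b' - p.comp b := by
      have := Polynomial.sub_dvd_eval_sub b' b (p.map Polynomial.C)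
      simpa [Polynomial.eval_map, Polynomial.comp] using this
    obtain ⟨q, hq⟩ := hb.trans h1
    exact ⟨q, by rw [← hq]; ring⟩
  have hF := congrArg (Polynomial.comp · b) hf
  have hF' := congrArg (Polynomial.comp · b') hf
  simp only [Polynomial.add_comp, Polynomial.mul_comp, Polynomial.C_comp] at hF hF'
  choose q hq using key
  have hC : (Polynomial.C c : Polynomial A) ≠ 0 := by simpa using hc
  set F₁ := (f (.inl 0)).comp b
  set F₂ := (f (.inl 1)).comp b
  set H₁ := h₁.comp b
  set H₂ := h₂.comp b
  set G₁ := q (f (.inl 0))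
  set G₂ := q (f (.inl 1))
  set K₁ := q h₁
  set K₂ := q h₂
  rw [hq, hq, hq, hq] at hF'
  have hlin : G₁ * H₁ + F₁ * K₁ + G₂ * H₂ + F₂ * K₂ =
      - Polynomial.C c * (G₁ * K₁ + G₂ * K₂) := by
    apply mul_left_cancel₀ hC
    linear_combination hF' - hF
  refine ⟨Matrix.fromBlocks
    !![1 + G₁ * H₁ + K₂ * F₂, G₁ * H₂ - K₂ * F₁; G₂ * H₁ - K₁ * F₂, 1 + G₂ * H₂ + K₁ * F₁] 0
    (Matrix.of fun k j => q (f (.inr k)) * (if j = 0 then H₁ else H₂)) 1, ?_, ?_⟩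
  · rw [Matrix.det_fromBlocks_zero₁₂]
    simp only [Matrix.det_fin_two_of, Matrix.det_one, mul_one]
    convert isUnit_one
    linear_combination hlin + (G₁ * K₁ + G₂ * K₂) * hF
  · ext1 i
    rcases i with i | k
    · fin_cases i
      · simp [Matrix.mulVec, dotProduct, Fin.sum_univ_two, hq]
        linear_combination G₁ * hF
      · simp [Matrix.mulVec, dotProduct, Fin.sum_univ_two, hq]
        linear_combination G₂ * hF
    · simp [Matrix.mulVec, dotProduct, Fin.sum_univ_two, hq, Matrix.one_apply]
      linear_combination (q (f (.inr k))) * hF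

/-- A Bézout-type form of the stable range condition for quotients of a principal ideal domain
by a nonzero element. -/
theorem exists_isCoprime_add_mul_s11 {P : Type*} [CommRing P] [IsDomain P] [IsPrincipalIdealRing P]
    (f u v : P) (hf : f ≠ 0) (h : Ideal.span {f, u, v} = ⊤) : ∃ a, IsCoprime f (u + a * v) := by
  classical
  let S := (UniqueFactorizationMonoid.factors f).filter (fun p => ¬ p ∣ u)
  refine ⟨S.prod, ?_⟩
  refine isCoprime_of_prime_dvd (fun h0 => hf h0.1) ?_
  intro p hp hpf hpuv
  by_cases hpu : p ∣ u
  · have h1 : p ∣ S.prod * v := (dvd_add_right hpu).mp hpuv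
    rcases hp.dvd_or_dvd h1 with h2 | h2
    · obtain ⟨q, hq, hpq⟩ := hp.exists_mem_multiset_dvd h2
      have hq' := Multiset.mem_filter.mp hq
      have hqi := UniqueFactorizationMonoid.irreducible_of_factor q hq'.1
      exact hq'.2 (((hp.irreducible.associated_of_dvd hqi hpq).dvd_iff_dvd_left).mp hpu)
    · have : Ideal.span {f, u, v} ≤ Ideal.span {p} := by
        rw [Ideal.span_le]
        rintro x (rfl | rfl | rfl) <;> simpa [Ideal.mem_span_singleton]
      rw [h, top_le_iff, Ideal.span_singleton_eq_top] at this
      exact hp.not_isUnit this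
  · obtain ⟨q, hq, hpq⟩ := UniqueFactorizationMonoid.exists_mem_factors_of_dvd hf hp.irreducible hpf
    have h1 : p ∣ S.prod := by
      refine hpq.dvd.trans (Multiset.dvd_prod (Multiset.mem_filter.mpr ⟨hq, ?_⟩))
      exact fun h => hpu (hpq.dvd.trans h)
    exact hpu ((dvd_add_left (h1.mul_right v)).mp hpuv)

theorem exists_isCoprime_add_sum {P κ : Type*} [CommRing P] [IsDomain P] [IsPrincipalIdealRing P]
    [Fintype κ] (f : Fin 2 ⊕ κ → P) (hf : f (.inl 0) ≠ 0) (g : Fin 2 ⊕ κ → P)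
    (h : g ⬝ᵥ f = 1) : ∃ a : κ → P, IsCoprime (f (.inl 0)) (f (.inl 1) + ∑ k, a k * f (.inr k)) := by
  obtain ⟨v, hv⟩ := (IsPrincipalIdealRing.principal
    (Ideal.span (Set.range fun k => f (.inr k)))).principal
  rw [Ideal.submodule_span_eq] at hv
  have hmem : ∀ k, v ∣ f (.inr k) := fun k => by
    rw [← Ideal.mem_span_singleton, ← hv]
    exact Ideal.subset_span ⟨k, rfl⟩
  have hv' : v ∈ Ideal.span (Set.range fun k => f (.inr k)) := by
    rw [hv]; exact Ideal.mem_span_singleton_self v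
  obtain ⟨β, hβ⟩ := (Ideal.mem_span_range_iff_exists_fun).mp hv'
  obtain ⟨a, ha⟩ := exists_isCoprime_add_mul_s11 (f (.inl 0)) (f (.inl 1)) v hf (by
    rw [Ideal.eq_top_iff_one, ← h]
    simp only [dotProduct, Fintype.sum_sum_type, Fin.sum_univ_two]
    refine Ideal.add_mem _ (Ideal.add_mem _ ?_ ?_) (Ideal.sum_mem _ fun k _ => ?_) <;>
      apply Ideal.mul_mem_left
    · exact Ideal.subset_span (by simp)
    · exact Ideal.subset_span (by simp)
    · exact Ideal.mem_of_dvd _ (hmem k) (Ideal.subset_span (by simp)))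
  refine ⟨fun k => a * β k, ?_⟩
  convert ha using 2
  rw [← hβ, Finset.mul_sum]
  simp [mul_assoc]

theorem VecEquiv.add_sum {A κ : Type*} [CommRing A] [Fintype κ] [DecidableEq κ]
    (f : Fin 2 ⊕ κ → A) (a : κ → A) :
    VecEquiv f (Function.update f (.inl 1) (f (.inl 1) + ∑ k, a k * f (.inr k))) := by
  refine ⟨Matrix.fromBlocks 1 (Matrix.of fun i k => if i = 1 then a k else 0) 0 1, by simp, ?_⟩
  ext i
  rcases i with i | k
  · fin_cases i <;>
    simp [Matrix.mulVec, dotProduct]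
  · simp [Matrix.mulVec, dotProduct, Matrix.one_apply]

theorem Polynomial.exists_mul_add_mul_eq_C {A k : Type*} [CommRing A] [Field k] (φ : A →+* k)
    (f g : Polynomial A) (hf : f.Monic) (h : IsCoprime (f.map φ) (g.map φ)) :
    ∃ c, φ c ≠ 0 ∧ ∃ p q, f * p + g * q = Polynomial.C c := by
  obtain ⟨p, q, -, -, hpq⟩ := Polynomial.exists_mul_add_mul_eq_C_resultant (m := f.natDegree)
    (n := g.natDegree + 1) f g le_rfl (Nat.le_succ _) (by simp)
  refine ⟨_, ?_, p, q, hpq⟩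
  rw [← Polynomial.resultant_map_map]
  have hdeg : (g.map φ).natDegree ≤ g.natDegree := Polynomial.natDegree_map_le
  obtain ⟨k, hk⟩ := Nat.exists_eq_add_of_le (hdeg.trans (Nat.le_succ _))
  rw [Nat.succ_eq_add_one] at hk
  rw [hk, Polynomial.resultant_add_right_deg _ _ _ _ _ le_rfl]
  have h1 : (f.map φ).natDegree = f.natDegree := hf.natDegree_map _
  have h2 : (f.map φ).coeff f.natDegree = 1 := by
    rw [← h1]; exact hf.map φ
  rw [h2, one_pow, one_mul, ← h1]
  exact Polynomial.resultant_ne_zero _ _ h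

theorem Polynomial.exists_add_sum_mul_eq_C {A κ k : Type*} [CommRing A] [Fintype κ] [Field k]
    (φ : A →+* k) (hφ : Function.Surjective φ) (f g : Fin 2 ⊕ κ → Polynomial A)
    (hf : (f (.inl 0)).Monic) (h : g ⬝ᵥ f = 1) :
    ∃ a : κ → Polynomial A, ∃ c, φ c ≠ 0 ∧ ∃ p q,
      f (.inl 0) * p + (f (.inl 1) + ∑ k, a k * f (.inr k)) * q = Polynomial.C c := by
  obtain ⟨a, ha⟩ := exists_isCoprime_add_sum (fun i => (f i).map φ) (hf.map φ).ne_zero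
    (fun i => (g i).map φ) (by
      have := congrArg (Polynomial.map φ) h
      simpa [dotProduct, Polynomial.map_sum] using this)
  choose a' ha' using fun k => Polynomial.map_surjective φ hφ (a k)
  refine ⟨a', Polynomial.exists_mul_add_mul_eq_C φ _ _ hf ?_⟩
  simpa [Polynomial.map_sum, ha'] using ha

/-- Suslin's theorem: a unimodular vector over `A[X]` with a monic coordinate is equivalent to its
value at `0`. -/
theorem Polynomial.vecEquiv_C_eval_zero {A κ : Type*} [CommRing A] [IsDomain A] [Fintype κ]
    [DecidableEq κ] (f g : Fin 2 ⊕ κ → Polynomial A) (hf : (f (.inl 0)).Monic)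
    (h : g ⬝ᵥ f = 1) : VecEquiv f (fun i => Polynomial.C ((f i).eval 0)) := by
  let I : Ideal A :=
    { carrier := {c | ∀ b b' : Polynomial A, Polynomial.C c ∣ b' - b →
        VecEquiv (fun i => (f i).comp b) (fun i => (f i).comp b')}
      zero_mem' := by
        intro b b' hb
        rw [Polynomial.C_0, zero_dvd_iff, sub_eq_zero] at hb
        rw [hb]
        exact VecEquiv.refl _
      add_mem' := by
        rintro c₁ c₂ h₁ h₂ b b' ⟨d, hd⟩
        refine (h₁ b (b + Polynomial.C c₁ * d) (by simp)).trans (h₂ _ _ ⟨d, ?_⟩)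
        rw [Polynomial.C_add] at hd
        linear_combination hd
      smul_mem' := by
        intro a c hc b b' hb
        refine hc b b' (dvd_trans ?_ hb)
        simp }
  have hI : I = ⊤ := by
    by_contra hne
    obtain ⟨m, hm, hIm⟩ := Ideal.exists_le_maximal I hne
    obtain ⟨a', c, hc, p, q, hpq⟩ := @Polynomial.exists_add_sum_mul_eq_C A κ (A ⧸ m) _ _
      (Ideal.Quotient.field m) (Ideal.Quotient.mk m) Ideal.Quotient.mk_surjective f g hf h
    have hcm : c ∉ m := fun h => hc (Ideal.Quotient.eq_zero_iff_mem.mpr h)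
    refine hcm (hIm fun b b' hb => ?_)
    have hupd : ∀ b : Polynomial A, (fun i => (Function.update f (.inl 1)
        (f (.inl 1) + ∑ k, a' k * f (.inr k)) i).comp b) =
        Function.update (fun i => (f i).comp b) (.inl 1)
          ((f (.inl 1)).comp b + ∑ k, (a' k).comp b * (f (.inr k)).comp b) := by
      intro b
      ext1 i
      by_cases hi : i = .inl 1
      · subst hi; simp [Polynomial.sum_comp]
      · simp [Function.update_of_ne hi]
    have hstep := Polynomial.vecEquiv_comp_of_sub_dvd
      (Function.update f (.inl 1) (f (.inl 1) + ∑ k, a' k * f (.inr k))) p q c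
      (fun h0 => hcm (h0 ▸ m.zero_mem)) (by simpa using hpq) b b' hb
    rw [hupd, hupd] at hstep
    exact ((VecEquiv.add_sum _ _).trans hstep).trans (VecEquiv.add_sum _ _).symm
  have h1 : (1 : A) ∈ I := hI ▸ Submodule.mem_top
  have := h1 Polynomial.X 0 (by simp)
  simpa [Polynomial.comp_zero] using this

namespace MvPolynomial

variable {k : Type*} [Field k] {n : ℕ} (f : MvPolynomial (Fin (n + 1)) k)

/-- The substitution fixing `X 0` and mapping `X i` to `X i + c • X 0 ^ N ^ i` for `i ≠ 0`, where
`N` exceeds the total degree of `f`. -/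
noncomputable def shiftHom (c : k) :
    MvPolynomial (Fin (n + 1)) k →ₐ[k] MvPolynomial (Fin (n + 1)) k :=
  aeval fun i => if i = 0 then X 0 else X i + c • X 0 ^ (2 + f.totalDegree) ^ i.1

theorem shiftHom_comp_neg (c : k) : (shiftHom f c).comp (shiftHom f (-c)) = AlgHom.id _ _ := by
  rw [shiftHom, shiftHom, comp_aeval, ← MvPolynomial.aeval_X_left]
  ext i v
  cases i using Fin.cases <;> simp

/-- The automorphism of the polynomial ring given by `shiftHom f 1`. -/
noncomputable def shiftEquiv :
    MvPolynomial (Fin (n + 1)) k ≃ₐ[k] MvPolynomial (Fin (n + 1)) k :=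
  AlgEquiv.ofAlgHom (shiftHom f 1) (shiftHom f (-1))
    (shiftHom_comp_neg f 1) (by simpa using shiftHom_comp_neg f (-1))

theorem finSuccEquiv_shiftEquiv_X_monic (j : Fin (n + 1)) :
    (finSuccEquiv k n (shiftEquiv f (X j))).Monic ∧
      (finSuccEquiv k n (shiftEquiv f (X j))).natDegree = (2 + f.totalDegree) ^ j.1 := by
  cases j using Fin.cases with
  | zero => simp [shiftEquiv, shiftHom, finSuccEquiv_X_zero, Polynomial.monic_X]
  | succ i =>
    have : finSuccEquiv k n (shiftEquiv f (X i.succ)) =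
        Polynomial.X ^ (2 + f.totalDegree) ^ (i.1 + 1) + Polynomial.C (X i) := by
      simp [shiftEquiv, shiftHom, finSuccEquiv_X_zero, finSuccEquiv_X_succ, add_comm]
    rw [this]
    exact ⟨Polynomial.monic_X_pow_add_C _ (by positivity), by simp⟩

theorem finSuccEquiv_shiftEquiv_monomial (v : Fin (n + 1) →₀ ℕ) {a : k} (ha : a ≠ 0) :
    (finSuccEquiv k n (shiftEquiv f (monomial v a))).leadingCoeff = C a ∧
    (finSuccEquiv k n (shiftEquiv f (monomial v a))).natDegree =
      ∑ i : Fin (n + 1), (2 + f.totalDegree) ^ i.1 * v i := by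
  have h0 : finSuccEquiv k n (shiftEquiv f (monomial v a)) =
      Polynomial.C (C a) * ∏ i, finSuccEquiv k n (shiftEquiv f (X i)) ^ v i := by
    rw [monomial_eq, Finsupp.prod_pow v fun a => X a]
    simp only [map_mul, map_prod, map_pow]
    congr 1
    rw [← algebraMap_eq, AlgEquiv.commutes, AlgEquiv.commutes]
    rfl
  have hm : ∀ i ∈ Finset.univ, (finSuccEquiv k n (shiftEquiv f (X i)) ^ v i).Monic :=
    fun i _ => (finSuccEquiv_shiftEquiv_X_monic f i).1.pow _
  have hM := Polynomial.monic_prod_of_monic _ _ hm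
  rw [h0]
  constructor
  · rw [Polynomial.leadingCoeff_mul_monic hM, Polynomial.leadingCoeff_C]
  · rw [Polynomial.natDegree_C_mul (by simpa using ha), Polynomial.natDegree_prod_of_monic _ _ hm]
    refine Finset.sum_congr rfl fun i _ => ?_
    rw [(finSuccEquiv_shiftEquiv_X_monic f i).1.natDegree_pow,
      (finSuccEquiv_shiftEquiv_X_monic f i).2, mul_comm]

theorem sum_pow_mul_injOn {N : ℕ} (hN : 1 < N) (v w : Fin n →₀ ℕ) (hv : ∀ i, v i < N)
    (hw : ∀ i, w i < N) (h : ∑ i : Fin n, N ^ i.1 * v i = ∑ i : Fin n, N ^ i.1 * w i) :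
    v = w := by
  refine Finsupp.ext <| congrFun <| List.ofFn_inj.mp ?_
  apply Nat.ofDigits_inj_of_len_eq hN (by simp) (by simpa [List.forall_mem_ofFn_iff] using hv)
    (by simpa [List.forall_mem_ofFn_iff] using hw)
  simpa only [Nat.ofDigits_eq_sum_mapIdx, List.mapIdx_eq_ofFn, List.get_ofFn, List.length_ofFn,
    Fin.val_cast, mul_comm, List.sum_ofFn] using! h

theorem isUnit_leadingCoeff_finSuccEquiv_shiftEquiv (hf : f ≠ 0) :
    IsUnit (finSuccEquiv k n (shiftEquiv f f)).leadingCoeff := by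
  set D : (Fin (n + 1) →₀ ℕ) → ℕ := fun v => ∑ i : Fin (n + 1), (2 + f.totalDegree) ^ i.1 * v i
  set h := fun w => finSuccEquiv k n (shiftEquiv f (monomial w (coeff w f)))
  obtain ⟨v, hv, hmax⟩ := Finset.exists_max_image f.support D (support_nonempty.mpr hf)
  have hlt : ∀ w ∈ f.support, ∀ i, w i < 2 + f.totalDegree := fun w hw i =>
    lt_of_le_of_lt ((monomial_le_degreeOf i hw).trans (degreeOf_le_totalDegree f i)) (by lia)
  have hdeg : ∀ w ∈ f.support.erase v, (h w).degree < (h v).degree := by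
    intro w hw
    obtain ⟨h1, h2⟩ := Finset.mem_erase.mp hw
    refine Polynomial.degree_lt_degree ?_
    rw [(finSuccEquiv_shiftEquiv_monomial f w (mem_support_iff.mp h2)).2,
      (finSuccEquiv_shiftEquiv_monomial f v (mem_support_iff.mp hv)).2]
    exact lt_of_le_of_ne (hmax w h2) fun h => h1
      (sum_pow_mul_injOn (by lia) _ _ (hlt w h2) (hlt v hv) h)
  have hlead := (finSuccEquiv_shiftEquiv_monomial f v (mem_support_iff.mp hv)).1
  have hsum : finSuccEquiv k n (shiftEquiv f f) = ∑ w ∈ f.support.erase v, h w + h v := by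
    rw [Finset.sum_erase_add _ _ hv]
    nth_rw 2 [← f.support_sum_monomial_coeff]
    simp only [map_sum, h]
  rw [hsum, Polynomial.leadingCoeff_add_of_degree_lt, hlead]
  · exact (mem_support_iff.mp hv).isUnit.map C
  · refine (Polynomial.degree_sum_le _ _).trans_lt ((Finset.sup_lt_iff ?_).mpr hdeg)
    rw [bot_lt_iff_ne_bot, Ne, Polynomial.degree_eq_bot, ← Polynomial.leadingCoeff_eq_zero, hlead]
    simpa using (mem_support_iff.mp hv)

end MvPolynomial

/-- A ring over which every unimodular vector can be mapped to a standard basis vector by an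
invertible matrix. -/
def IsHermite (A : Type*) [CommRing A] : Prop :=
  ∀ (m : ℕ) (f g : Fin m → A), g ⬝ᵥ f = 1 → ∀ j, VecEquiv f (Pi.single j 1)

theorem IsHermite.vecEquiv {A ι : Type*} [CommRing A] [Fintype ι] [DecidableEq ι]
    (hA : IsHermite A) (f g : ι → A) (h : g ⬝ᵥ f = 1) (j : ι) : VecEquiv f (Pi.single j 1) := by
  let e := Fintype.equivFin ι
  have := (hA _ (f ∘ e.symm) (g ∘ e.symm) (by
    rw [← h]; exact Equiv.sum_comp e.symm fun i => g i * f i) (e j)).comp_equiv e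
  convert this using 1
  · ext; simp
  · ext i; simp [Pi.single_apply]

theorem IsHermite.vecEquiv_polynomial {A κ : Type*} [CommRing A] [IsDomain A] [Fintype κ]
    [DecidableEq κ] (hA : IsHermite A) (f g : Fin 2 ⊕ κ → Polynomial A)
    (hf : IsUnit (f (.inl 0)).leadingCoeff) (h : g ⬝ᵥ f = 1) (j : Fin 2 ⊕ κ) :
    VecEquiv f (Pi.single j 1) := by
  obtain ⟨u, hu⟩ := hf
  have huu : (Polynomial.C (↑u : A)) * Polynomial.C (↑u⁻¹ : A) = 1 := by
    rw [← Polynomial.C_mul]; simp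
  have h1 : VecEquiv f (Polynomial.C (↑u⁻¹ : A) • f) := by
    refine ⟨Matrix.scalar _ (Polynomial.C (↑u⁻¹ : A)), ?_, ?_⟩
    · simp only [Matrix.scalar_apply, Matrix.det_diagonal, Finset.prod_const]
      exact (IsUnit.of_mul_eq_one_right _ huu).pow _
    · ext1 i; simp [Matrix.scalar_apply, Matrix.mulVec_diagonal]
  have h2 : (Polynomial.C (↑u : A) • g) ⬝ᵥ (Polynomial.C (↑u⁻¹ : A) • f) = 1 := by
    rw [smul_dotProduct, dotProduct_smul, h, smul_eq_mul, smul_eq_mul, mul_one, huu]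
  have hmon : ((Polynomial.C (↑u⁻¹ : A) • f) (.inl 0)).Monic := by
    simp [Polynomial.Monic, ← hu]
  refine (h1.trans (Polynomial.vecEquiv_C_eval_zero _ _ hmon h2)).trans ?_
  have h3 := congrArg (Polynomial.eval 0) h2
  have h4 := (hA.vecEquiv (fun i => ((Polynomial.C (↑u⁻¹ : A) • f) i).eval 0)
    (fun i => ((Polynomial.C (↑u : A) • g) i).eval 0) (by
      simpa [dotProduct, Polynomial.eval_finsetSum] using h3) j).map Polynomial.C
  convert h4 using 1
  · ext1 i
    simp
  · ext1 i
    by_cases hij : i = j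
    · subst hij; simp
    · simp [hij]

/-- The Quillen–Suslin theorem for unimodular vectors: polynomial rings over a field are
Hermite rings. -/
theorem MvPolynomial.isHermite (K : Type*) [Field K] (n : ℕ) :
    IsHermite (MvPolynomial (Fin n) K) := by
  induction n with
  | zero =>
    intro m f g h j
    obtain ⟨i, hi⟩ : ∃ i, f i ≠ 0 := by
      by_contra! hne
      simp [dotProduct, hne] at h
    refine (VecEquiv.single_of_isUnit f i ?_).trans (VecEquiv.single_single i j)
    rw [← MulEquiv.isUnit_map (isEmptyAlgEquiv K (Fin 0))]
    exact isUnit_iff_ne_zero.mpr ((map_ne_zero_iff _ (AlgEquiv.injective _)).mpr hi)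
  | succ n ih =>
    intro m f g h j
    obtain ⟨i, hi⟩ : ∃ i, f i ≠ 0 := by
      by_contra! hne
      simp [dotProduct, hne] at h
    match m with
    | 0 => exact i.elim0
    | 1 =>
      refine (VecEquiv.single_of_isUnit f i ?_).trans (VecEquiv.single_single i j)
      refine IsUnit.of_mul_eq_one_right (g i) ?_
      rw [← h]
      simp [dotProduct, Subsingleton.elim i 0]
    | m + 2 =>
      let e₀ : Fin 2 ⊕ Fin m ≃ Fin (m + 2) := finSumFinEquiv.trans (finCongr (add_comm _ _))
      let e := e₀.trans (Equiv.swap (e₀ (.inl 0)) i)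
      have he : e (.inl 0) = i := by simp [e]
      let τ := (shiftEquiv (f i)).trans (finSuccEquiv K n)
      have h1 := ih.vecEquiv_polynomial (fun a => τ (f (e a))) (fun a => τ (g (e a))) (by
        rw [he]; exact isUnit_leadingCoeff_finSuccEquiv_shiftEquiv (f i) hi) (by
        have h2 := congrArg τ h
        rw [map_one] at h2
        rw [← h2, dotProduct, dotProduct, ← Equiv.sum_comp e, map_sum]
        simp) (e.symm j)
      have h3 := (h1.comp_equiv e.symm).map (τ.symm : _ →+* MvPolynomial (Fin (n + 1)) K)
      convert h3 using 1
      · ext1 a; simp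
      · ext1 a
        by_cases haj : a = j
        · subst haj; simp
        · simp [haj]

theorem IsHermite.exists_vecMul_eq {A ι : Type*} [CommRing A] [Fintype ι] [DecidableEq ι]
    (hA : IsHermite A) (p : ι → Prop) [DecidablePred p] (u y : ι → A) (hy : ∀ i, ¬ p i → y i = 0)
    (h : ∑ i, u i * y i = 1) (i₀ : ι) (hi₀ : p i₀) :
    ∃ Q : Matrix ι ι A, IsUnit Q.det ∧
      (∀ i j, ¬ (p i ∧ p j) → Q i j = (1 : Matrix ι ι A) i j) ∧
      ∀ j, p j → (u ᵥ* Q) j = if j = i₀ then 1 else 0 := by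
  have h' : (fun i : {i // p i} => y i) ⬝ᵥ (fun i : {i // p i} => u i) = 1 := by
    rw [← h, ← Fintype.sum_subtype_add_sum_subtype p]
    rw [Finset.sum_eq_zero (s := (Finset.univ : Finset {i // ¬ p i}))
      (fun i _ => by simp [hy i i.2]), add_zero]
    simp [dotProduct, mul_comm]
  obtain ⟨M, hM, hMu⟩ := hA.vecEquiv _ _ h' ⟨i₀, hi₀⟩
  have happ : ∀ a b, (Matrix.fromBlocks Mᵀ 0 0 1).submatrix (Equiv.sumCompl p).symm
      (Equiv.sumCompl p).symm (Equiv.sumCompl p a) (Equiv.sumCompl p b) =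
      (Matrix.fromBlocks Mᵀ 0 0 1) a b := fun a b => by simp
  refine ⟨(Matrix.fromBlocks Mᵀ 0 0 1).submatrix (Equiv.sumCompl p).symm (Equiv.sumCompl p).symm,
    by simpa using hM, ?_, ?_⟩
  · intro i j hij
    obtain ⟨a, rfl⟩ := (Equiv.sumCompl p).surjective i
    obtain ⟨b, rfl⟩ := (Equiv.sumCompl p).surjective j
    rw [happ]
    rcases a with a | a <;> rcases b with b | b
    · exact absurd ⟨a.2, b.2⟩ hij
    · have hne : (a : ι) ≠ b := fun h => b.2 (h ▸ a.2)
      simp [Matrix.one_apply, hne]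
    · have hne : (a : ι) ≠ b := fun h => a.2 (h ▸ b.2)
      simp [Matrix.one_apply, hne]
    · by_cases hab : a = b
      · subst hab; simp
      · have hne : (a : ι) ≠ b := fun h => hab (Subtype.ext h)
        simp [Matrix.one_apply, hab, hne]
  · intro j hj
    have h1 := congrFun hMu ⟨j, hj⟩
    rw [Matrix.vecMul, dotProduct, ← Equiv.sum_comp (Equiv.sumCompl p), Fintype.sum_sum_type]
    have hj' : j = Equiv.sumCompl p (.inl ⟨j, hj⟩) := rfl
    rw [hj']
    simp only [happ]
    by_cases hji : j = i₀
    · subst hji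
      simpa [Matrix.mulVec, dotProduct, mul_comm] using h1
    · rw [Pi.single_eq_of_ne (by simpa using hji)] at h1
      simpa [Matrix.mulVec, dotProduct, mul_comm, hji] using h1

namespace Matrix

variable {A : Type*} [CommRing A] {l : ℕ}

theorem mul_apply_of_row_eq_one {M : Matrix (Fin l) (Fin l) A} {i : Fin l}
    (h : ∀ j, M i j = (1 : Matrix (Fin l) (Fin l) A) i j) (N : Matrix (Fin l) (Fin l) A)
    (j : Fin l) : (M * N) i j = N i j := by
  simp [Matrix.mul_apply, h, Matrix.one_apply]

theorem lowerLeft_mul {t : ℕ} {P Q : Matrix (Fin l) (Fin l) A}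
    (hP : ∀ i j : Fin l, t ≤ i → (j : ℕ) < t → P i j = 0)
    (hQ : ∀ i j : Fin l, t ≤ i → (j : ℕ) < t → Q i j = 0) :
    ∀ i j : Fin l, t ≤ i → (j : ℕ) < t → (P * Q) i j = 0 := by
  intro i j hi hj
  rw [Matrix.mul_apply]
  refine Finset.sum_eq_zero fun k _ => ?_
  rcases lt_or_ge (k : ℕ) t with hk | hk
  · rw [hP i k hi hk, zero_mul]
  · rw [hQ k j hk hj, mul_zero]

theorem lowerLeft_inv {t : ℕ} {Q : Matrix (Fin l) (Fin l) A} (hdet : IsUnit Q.det)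
    (hQ : ∀ i j : Fin l, t ≤ i → (j : ℕ) < t → Q i j = 0) :
    ∀ i j : Fin l, t ≤ i → (j : ℕ) < t → Q⁻¹ i j = 0 := by
  intro i j hi hj
  let := Matrix.invertibleOfIsUnitDet Q hdet
  refine Matrix.blockTriangular_inv_of_blockTriangular
    (b := fun k : Fin l => if (k : ℕ) < t then 0 else 1) ?_ ?_
  · intro i j hij
    simp only at hij
    refine hQ i j ?_ ?_ <;> grind
  · grind

theorem rows_mul_of_lowerRows_zero {t : ℕ} {Q Y : Matrix (Fin l) (Fin l) A}
    (hQ : ∀ i j : Fin l, t ≤ i → (j : ℕ) < t → Q i j = 0)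
    (hY : ∀ i k : Fin l, t ≤ i → Y i k = 0) :
    ∀ i k : Fin l, t ≤ i → (Q * Y) i k = 0 := by
  intro i k hi
  rw [Matrix.mul_apply]
  refine Finset.sum_eq_zero fun j _ => ?_
  rcases lt_or_ge (j : ℕ) t with hj | hj
  · rw [hQ i j hi hj, zero_mul]
  · rw [hY j k hj, mul_zero]

/-- If the first `c` rows of `U` have a right inverse supported on the first `t` coordinates, they
can be brought to the standard form by column operations that preserve the span of the first `t`
coordinates. -/
theorem exists_mul_rows_eq_one (hA : IsHermite A) {t : ℕ} (htl : t ≤ l)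
    (U Y : Matrix (Fin l) (Fin l) A) (hY : ∀ i k : Fin l, t ≤ i → Y i k = 0) (c : ℕ) (hc : c ≤ t)
    (h : ∀ i k : Fin l, (i : ℕ) < c → (k : ℕ) < c →
      (U * Y) i k = (1 : Matrix (Fin l) (Fin l) A) i k) :
    ∃ Q : Matrix (Fin l) (Fin l) A, IsUnit Q.det ∧
      (∀ i j : Fin l, t ≤ i → (j : ℕ) < t → Q i j = 0) ∧
      ∀ i j : Fin l, (i : ℕ) < c → (U * Q) i j = (1 : Matrix (Fin l) (Fin l) A) i j := by
  induction c with
  | zero =>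
    refine ⟨1, by simp, fun i j hi hj => Matrix.one_apply_ne ?_, by simp⟩
    rintro rfl
    omega
  | succ c ih =>
    obtain ⟨Q, hQdet, hQ, hUQ⟩ := ih (by omega) fun i k hi hk => h i k (by omega) (by omega)
    obtain ⟨e, he⟩ : ∃ e : Fin l, (e : ℕ) = c := ⟨⟨c, by omega⟩, rfl⟩
    have hUY : U * Q * (Q⁻¹ * Y) = U * Y := by
      rw [Matrix.mul_assoc, ← Matrix.mul_assoc Q, Matrix.mul_nonsing_inv _ hQdet, Matrix.one_mul]
    have hY' := rows_mul_of_lowerRows_zero (lowerLeft_inv hQdet hQ) hY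
    obtain ⟨G, hGdet, hG, hGe⟩ := hA.exists_vecMul_eq (fun j : Fin l => c ≤ j ∧ (j : ℕ) < t)
      ((U * Q) e) (fun j => (Q⁻¹ * Y) j e) (by
        intro i hi
        rcases lt_or_ge (i : ℕ) c with hic | hic
        · have h1 := h i e (by omega) (by omega)
          rw [← hUY, mul_apply_of_row_eq_one (fun j => hUQ i j hic)] at h1
          simp only [h1]
          exact Matrix.one_apply_ne (by rintro rfl; omega)
        · exact hY' i e (by omega)) (by
        have h1 := h e e (by omega) (by omega)
        rwa [← hUY, Matrix.one_apply_eq, Matrix.mul_apply] at h1) e (by omega)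
    set V := U * Q * G with hV
    have hVlt : ∀ i j : Fin l, (i : ℕ) < c → V i j = (1 : Matrix (Fin l) (Fin l) A) i j := by
      intro i j hi
      rw [hV, mul_apply_of_row_eq_one (fun j => hUQ i j hi)]
      exact hG i j (by omega)
    have hVe : V e e = 1 := by
      have := hGe e (by omega)
      rw [if_pos rfl] at this
      exact this
    have hVe' : ∀ j : Fin l, c < j → (j : ℕ) < t → V e j = 0 := by
      intro j hj hj'
      have := hGe j (by omega)
      rw [if_neg (by rintro rfl; omega)] at this
      exact this
    let E : Matrix (Fin l) (Fin l) A :=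
      (1 : Matrix (Fin l) (Fin l) A).updateRow e (fun j => if j = e then 1 else - V e j)
    have hEdet : E.det = 1 := by
      simp only [E]
      rw [← Matrix.det_transpose, ← Matrix.updateCol_transpose, Matrix.transpose_one,
        ← Matrix.cramer_apply, Matrix.cramer_one]
      simp
    have hE : ∀ i j, i ≠ e → E i j = (1 : Matrix (Fin l) (Fin l) A) i j := fun i j hi => by
      simp [E, Matrix.updateRow_ne hi]
    have hEe : ∀ j, E e j = if j = e then 1 else - V e j := fun j => by simp [E]
    have hVE : ∀ i j, (V * E) i j = V i e * (if j = e then 1 else - V e j) +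
        (if j = e then 0 else V i j) := by
      intro i j
      rw [Matrix.mul_apply, ← Finset.add_sum_erase _ _ (Finset.mem_univ e), hEe]
      congr 1
      rw [Finset.sum_congr rfl fun k hk => by rw [hE k j (Finset.ne_of_mem_erase hk)]]
      simp only [Matrix.one_apply, mul_ite, mul_one, mul_zero, Finset.sum_ite_eq',
        Finset.mem_erase, Finset.mem_univ, and_true]
      simp
    refine ⟨Q * G * E, ?_, lowerLeft_mul (lowerLeft_mul hQ ?_) ?_, ?_⟩
    · rw [Matrix.det_mul, Matrix.det_mul, hEdet, mul_one]
      exact hQdet.mul hGdet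
    · intro i j hi hj
      rw [hG i j (by omega)]
      exact Matrix.one_apply_ne (by rintro rfl; omega)
    · intro i j hi hj
      rw [hE i j (by rintro rfl; omega)]
      exact Matrix.one_apply_ne (by rintro rfl; omega)
    · intro i j hi
      rw [← Matrix.mul_assoc, ← Matrix.mul_assoc, ← hV, hVE]
      rcases Nat.lt_succ_iff_lt_or_eq.mp hi with hi | hi
      · rw [hVlt i e hi, hVlt i j hi, Matrix.one_apply_ne (by rintro rfl; omega : i ≠ e)]
        by_cases hj : j = e
        · subst hj
          rw [Matrix.one_apply_ne (by rintro rfl; omega)]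
          simp
        · simp [hj]
      · obtain rfl : i = e := Fin.ext (by omega)
        rw [hVe]
        by_cases hj : j = i
        · subst hj; simp
        · rw [Matrix.one_apply_ne (Ne.symm hj)]
          simp [hj]

/-- A matrix congruent to the identity modulo `x` can be made lower triangular modulo any power of
`x` by upper triangular column operations. -/
theorem exists_mul_lowerTriangular_mod (x : A) (a : ℕ) (M : Matrix (Fin l) (Fin l) A)
    (hM : ∀ i j, x ∣ (M - 1) i j)
    (ha : ∀ i j : Fin l, (i : ℕ) < a → M i j = (1 : Matrix (Fin l) (Fin l) A) i j) (N : ℕ) :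
    ∃ T : Matrix (Fin l) (Fin l) A, T.det = 1 ∧ (∀ i j, j < i → T i j = 0) ∧
      (∀ i j, x ∣ (M * T - 1) i j) ∧ (∀ i j, i < j → x ^ (N + 1) ∣ (M * T) i j) ∧
      ∀ i j : Fin l, (i : ℕ) < a → (M * T) i j = (1 : Matrix (Fin l) (Fin l) A) i j := by
  induction N with
  | zero =>
    refine ⟨1, by simp, fun i j h => Matrix.one_apply_ne h.ne', by simpa using hM, ?_,
      by simpa using ha⟩
    intro i j hij
    simpa [Matrix.one_apply_ne hij.ne] using hM i j
  | succ N ih =>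
    obtain ⟨T, hdet, hT, h1, h2, h3⟩ := ih
    set W := M * T
    let S : Matrix (Fin l) (Fin l) A := Matrix.of fun i j => if i < j then W i j else 0
    have hS : ∀ i j, x ^ (N + 1) ∣ S i j := fun i j => by
      by_cases hij : i < j
      · simpa [S, hij] using h2 i j hij
      · simp [S, hij]
    have htri : ∀ i j, j < i → (1 - S) i j = 0 := fun i j h => by
      simp [S, h.not_gt, Matrix.one_apply_ne h.ne']
    have hdetS : (1 - S).det = 1 := by
      rw [Matrix.det_of_isUpperTriangular (fun i j h => htri i j h)]
      simp [S]
    have hW : M * (T * (1 - S)) = W - S - (W - 1) * S := by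
      rw [← Matrix.mul_assoc]
      simp only [Matrix.mul_sub, Matrix.sub_mul, Matrix.mul_one, Matrix.one_mul]
      simp [W]
    have hdvd : ∀ i j, x ^ (N + 1 + 1) ∣ ((W - 1) * S) i j := fun i j => by
      rw [Matrix.mul_apply]
      refine Finset.dvd_sum fun k _ => ?_
      rw [pow_succ']
      exact mul_dvd_mul (h1 i k) (hS k j)
    refine ⟨T * (1 - S), by rw [Matrix.det_mul, hdet, hdetS, one_mul], ?_, ?_, ?_, ?_⟩
    · intro i j hij
      rw [Matrix.mul_apply]
      refine Finset.sum_eq_zero fun k _ => ?_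
      rcases lt_or_ge k i with hk | hk
      · rw [hT i k hk, zero_mul]
      · rw [htri k j (hij.trans_le hk), mul_zero]
    · intro i j
      rw [hW, sub_right_comm, sub_right_comm W, Matrix.sub_apply, Matrix.sub_apply]
      exact dvd_sub (dvd_sub (h1 i j) ((dvd_pow_self x (by omega)).trans (hS i j)))
        ((dvd_pow_self x (by omega)).trans (hdvd i j))
    · intro i j hij
      rw [hW, Matrix.sub_apply, Matrix.sub_apply]
      simpa [S, hij] using hdvd i j
    · intro i j hi
      rw [← Matrix.mul_assoc, mul_apply_of_row_eq_one (fun j => h3 i j hi), Matrix.sub_apply,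
        sub_eq_self]
      by_cases hij : i < j
      · simp [S, hij, h3 i j hi, Matrix.one_apply_ne hij.ne]
      · simp [S, hij]

theorem exists_diagonal_mul_eq_mul_diagonal {A : Type*} [CommRing A] [IsDomain A] {l : ℕ}
    (d : Fin l → A) (hd : ∀ i, d i ≠ 0) (P : Matrix (Fin l) (Fin l) A)
    (h : ∀ i j, d j ∣ d i * P i j) :
    ∃ M : Matrix (Fin l) (Fin l) A, M.det = P.det ∧
      Matrix.diagonal d * P = M * Matrix.diagonal d := by
  choose m hm using h
  have heq : Matrix.diagonal d * P = Matrix.of m * Matrix.diagonal d := by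
    ext i j
    simp [Matrix.diagonal_mul, Matrix.mul_diagonal, hm, mul_comm]
  refine ⟨Matrix.of m, ?_, heq⟩
  have := congrArg Matrix.det heq
  rw [Matrix.det_mul, Matrix.det_mul, mul_comm] at this
  refine (mul_right_cancel₀ ?_ this).symm
  rw [Matrix.det_diagonal]
  exact Finset.prod_ne_zero_iff.mpr fun i _ => hd i

theorem exists_mul_diagonal_eq_diagonal_mul {A : Type*} [CommRing A] [IsDomain A] {l : ℕ}
    (e : Fin l → A) (he : ∀ i, e i ≠ 0) (Q : Matrix (Fin l) (Fin l) A)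
    (h : ∀ i j, e i ∣ Q i j * e j) :
    ∃ N : Matrix (Fin l) (Fin l) A, N.det = Q.det ∧
      Q * Matrix.diagonal e = Matrix.diagonal e * N := by
  obtain ⟨M, hM, hMe⟩ := exists_diagonal_mul_eq_mul_diagonal e he Qᵀ fun i j => by
    simpa [mul_comm] using h j i
  refine ⟨Mᵀ, by simpa using hM, ?_⟩
  simpa using congrArg Matrix.transpose hMe

end Matrix

theorem Finset.sum_le_sum_of_card_eq {α : Type*} [DecidableEq α] {I J : Finset α}
    (hcard : I.card = J.card) (w : α → ℕ) (W : ℕ) (hJ : ∀ j ∈ J, w j ≤ W)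
    (hI : ∀ i ∉ J, W ≤ w i) : ∑ j ∈ J, w j ≤ ∑ i ∈ I, w i := by
  rw [← Finset.sum_inter_add_sum_sdiff J I, ← Finset.sum_inter_add_sum_sdiff I J,
    Finset.inter_comm]
  refine Nat.add_le_add_left ?_ _
  calc ∑ j ∈ J \ I, w j ≤ (J \ I).card • W :=
        Finset.sum_le_card_nsmul _ _ _ fun j hj => hJ j (Finset.mem_sdiff.mp hj).1
    _ = (I \ J).card • W := by rw [Finset.card_sdiff_comm hcard]
    _ ≤ ∑ i ∈ I \ J, w i :=
        Finset.card_nsmul_le_sum _ _ _ fun i hi => hI i (Finset.mem_sdiff.mp hi).2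

theorem Finset.sum_lt_sum_of_card_eq {α : Type*} [DecidableEq α] {I J : Finset α}
    (hcard : I.card = J.card) (w : α → ℕ) (W : ℕ) (hJ : ∀ j ∈ J, w j < W)
    (hI : ∀ i ∉ J, W ≤ w i) (hne : ∃ i ∈ I, i ∉ J) : ∑ j ∈ J, w j < ∑ i ∈ I, w i := by
  obtain ⟨i, hi, hiJ⟩ := hne
  have hpos : 0 < (J \ I).card := by
    rw [← Finset.card_sdiff_comm hcard]
    exact Finset.card_pos.mpr ⟨i, Finset.mem_sdiff.mpr ⟨hi, hiJ⟩⟩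
  rw [← Finset.sum_inter_add_sum_sdiff J I, ← Finset.sum_inter_add_sum_sdiff I J,
    Finset.inter_comm]
  refine Nat.add_lt_add_left ?_ _
  calc ∑ j ∈ J \ I, w j < ∑ j ∈ J \ I, W :=
        Finset.sum_lt_sum_of_nonempty (Finset.card_pos.mp hpos)
          fun j hj => hJ j (Finset.mem_sdiff.mp hj).1
    _ = (I \ J).card • W := by rw [Finset.card_sdiff_comm hcard, Finset.sum_const]
    _ ≤ ∑ i ∈ I \ J, w i :=
        Finset.card_nsmul_le_sum _ _ _ fun i hi => hI i (Finset.mem_sdiff.mp hi).2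

theorem Fin.sum_castLE_le_sum {c l : ℕ} (h : c ≤ l) (w : Fin l → ℕ) (W : ℕ)
    (h1 : ∀ j : Fin l, (j : ℕ) < c → w j ≤ W) (h2 : ∀ j : Fin l, c ≤ j → W ≤ w j)
    (ri : Fin c → Fin l) (hri : Function.Injective ri) :
    ∑ k, w (Fin.castLE h k) ≤ ∑ k, w (ri k) := by
  have := Finset.sum_le_sum_of_card_eq (I := Finset.univ.map ⟨ri, hri⟩)
    (J := Finset.univ.map (Fin.castLEEmb h)) (by simp) w W ?_ ?_
  · simpa using this
  · intro j hj
    obtain ⟨k, -, rfl⟩ := Finset.mem_map.mp hj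
    exact h1 _ k.2
  · intro j hj
    refine h2 j (not_lt.mp fun hlt => hj ?_)
    exact Finset.mem_map.mpr ⟨⟨j, hlt⟩, Finset.mem_univ _, rfl⟩

theorem Fin.sum_castLE_lt_sum {c l : ℕ} (h : c ≤ l) (w : Fin l → ℕ) (W : ℕ)
    (h1 : ∀ j : Fin l, (j : ℕ) < c → w j < W) (h2 : ∀ j : Fin l, c ≤ j → W ≤ w j)
    (ri : Fin c → Fin l) (hri : Function.Injective ri) (hex : ∃ k, c ≤ (ri k : ℕ)) :
    ∑ k, w (Fin.castLE h k) < ∑ k, w (ri k) := by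
  have := Finset.sum_lt_sum_of_card_eq (I := Finset.univ.map ⟨ri, hri⟩)
    (J := Finset.univ.map (Fin.castLEEmb h)) (by simp) w W ?_ ?_ ?_
  · simpa using this
  · intro j hj
    obtain ⟨k, -, rfl⟩ := Finset.mem_map.mp hj
    exact h1 _ k.2
  · intro j hj
    refine h2 j (not_lt.mp fun hlt => hj ?_)
    exact Finset.mem_map.mpr ⟨⟨j, hlt⟩, Finset.mem_univ _, rfl⟩
  · obtain ⟨k, hk⟩ := hex
    refine ⟨ri k, by simp, fun hmem => ?_⟩
    obtain ⟨m, -, hm⟩ := Finset.mem_map.mp hmem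
    have : (m : ℕ) = ri k := congrArg Fin.val hm
    omega

namespace Matrix

/-- The elements of `S` that a matrix supported on the first `t` rows can produce as multiples of
the identity when multiplied into the first `c` rows of `V`. -/
def rowsIdeal {S : Type*} [CommRing S] {l : ℕ} (t c : ℕ) (V : Matrix (Fin l) (Fin l) S) :
    Ideal S where
  carrier := {z | ∃ Y : Matrix (Fin l) (Fin l) S, (∀ i k : Fin l, t ≤ i → Y i k = 0) ∧
    ∀ i k : Fin l, (i : ℕ) < c → (k : ℕ) < c →
      (V * Y) i k = z * (1 : Matrix (Fin l) (Fin l) S) i k}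
  zero_mem' := ⟨0, by simp, by simp⟩
  add_mem' := by
    rintro z w ⟨Y, hY, hVY⟩ ⟨Z, hZ, hVZ⟩
    refine ⟨Y + Z, fun i k hi => by simp [hY i k hi, hZ i k hi], fun i k hi hk => ?_⟩
    rw [Matrix.mul_add, Matrix.add_apply, hVY i k hi hk, hVZ i k hi hk, add_mul]
  smul_mem' := by
    rintro z w ⟨Y, hY, hVY⟩
    refine ⟨z • Y, fun i k hi => by simp [hY i k hi], fun i k hi hk => ?_⟩
    rw [Matrix.mul_smul, Matrix.smul_apply, hVY i k hi hk, smul_eq_mul, smul_eq_mul, mul_assoc]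

theorem det_submatrix_mem_rowsIdeal {S : Type*} [CommRing S] {l t c : ℕ}
    (V : Matrix (Fin l) (Fin l) S) (ri ci : Fin c → Fin l) (hri : Function.Injective ri)
    (hrc : ∀ k, (ri k : ℕ) < c) (hct : ∀ k, (ci k : ℕ) < t) :
    (V.submatrix ri ci).det ∈ rowsIdeal t c V := by
  let C : Matrix (Fin l) (Fin c) S := Matrix.of fun i p => if ci p = i then 1 else 0
  let Q : Matrix (Fin c) (Fin l) S := Matrix.of fun q k => if ri q = k then 1 else 0
  refine ⟨C * (V.submatrix ri ci).adjugate * Q, fun i k hi => ?_, fun i k hi hk => ?_⟩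
  · have hC : ∀ p, C i p = 0 := fun p => by
      have : ci p ≠ i := by
        rintro rfl
        have := hct p
        omega
      simp [C, this]
    simp [Matrix.mul_assoc, Matrix.mul_apply (M := C), hC]
  · have hbij : Function.Bijective (fun m => (⟨ri m, hrc m⟩ : Fin c)) :=
      Finite.injective_iff_bijective.mp fun m m' h => hri (Fin.ext (Fin.mk.inj h))
    obtain ⟨m, hm⟩ := hbij.2 ⟨i, hi⟩
    obtain rfl : ri m = i := Fin.ext (Fin.mk.inj hm)
    have hVC : ∀ p, (V * C) (ri m) p = V.submatrix ri ci m p := fun p => by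
      simp [Matrix.mul_apply, C]
    have : (V * (C * (V.submatrix ri ci).adjugate * Q)) (ri m) k =
        (V.submatrix ri ci * (V.submatrix ri ci).adjugate * Q) m k := by
      simp only [← Matrix.mul_assoc]
      rw [Matrix.mul_assoc, Matrix.mul_apply, Matrix.mul_assoc, Matrix.mul_apply]
      exact Finset.sum_congr rfl fun p _ => by rw [hVC]
    rw [this, Matrix.mul_adjugate]
    simp [Q, Matrix.one_apply]

end Matrix

theorem JEqTop.exists_mul_rows_eq_one {R S : Type*} [CommRing R] [IsDomain R] [CommRing S]
    (θ : R →+* S) {x y : R} (hx : x ≠ 0) (hy : y ≠ 0) (hθ : θ y = 0) {t c l : ℕ}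
    (hcl : c ≤ l) (p q : Fin l → ℕ) (U B : Matrix (Fin l) (Fin l) R)
    (hB : B = Matrix.diagonal (fun j => x ^ p j * y ^ q j) * U *
      Matrix.diagonal (fun j : Fin l => if (j : ℕ) < t then 1 else y))
    (hJ : JEqTop c B)
    (hd : ∀ d, IsGcdMinors c B d → Associated d
      (x ^ (∑ k, p (Fin.castLE hcl k)) * y ^ (∑ k, q (Fin.castLE hcl k))))
    (hp : ∀ ri : Fin c → Fin l, Function.Injective ri →
      ∑ k, p (Fin.castLE hcl k) ≤ ∑ k, p (ri k))
    (hq : ∀ ri : Fin c → Fin l, Function.Injective ri →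
      ∑ k, q (Fin.castLE hcl k) ≤ ∑ k, q (ri k))
    (hlt : ∀ ri : Fin c → Fin l, Function.Injective ri → (∃ k, c ≤ (ri k : ℕ)) →
      ∑ k, q (Fin.castLE hcl k) < ∑ k, q (ri k) ∨
        (θ x = 0 ∧ ∑ k, p (Fin.castLE hcl k) < ∑ k, p (ri k))) :
    ∃ Y : Matrix (Fin l) (Fin l) S, (∀ i k : Fin l, t ≤ i → Y i k = 0) ∧
      ∀ i k : Fin l, (i : ℕ) < c → (k : ℕ) < c →
        (U.map θ * Y) i k = (1 : Matrix (Fin l) (Fin l) S) i k := by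
  suffices h : (1 : S) ∈ Matrix.rowsIdeal t c (U.map θ) by
    obtain ⟨Y, hY, hVY⟩ := h
    exact ⟨Y, hY, fun i k hi hk => by rw [hVY i k hi hk, one_mul]⟩
  obtain ⟨d, hdg, hspan⟩ := hJ
  obtain ⟨u, hu⟩ := hd d hdg
  rw [← Ideal.eq_top_iff_one, eq_top_iff, ← Ideal.map_top θ, ← hspan, Ideal.map_span,
    Ideal.span_le]
  rintro _ ⟨b, ⟨ri, ci, hri, hci, hb⟩, rfl⟩
  obtain ⟨m, hm⟩ := Nat.exists_eq_add_of_le (hp ri hri)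
  obtain ⟨n, hn⟩ := Nat.exists_eq_add_of_le (hq ri hri)
  have hsub : B.submatrix ri ci = Matrix.diagonal (fun k => x ^ p (ri k) * y ^ q (ri k)) *
      U.submatrix ri ci * Matrix.diagonal (fun k => if (ci k : ℕ) < t then 1 else y) := by
    ext i j
    simp [hB, Matrix.mul_diagonal, Matrix.diagonal_mul]
  have hb' : b = u * (x ^ m * y ^ n) * (U.submatrix ri ci).det *
      ∏ k, (if (ci k : ℕ) < t then 1 else y) := by
    rw [hsub, Matrix.det_mul, Matrix.det_mul, Matrix.det_diagonal, Matrix.det_diagonal,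
      Finset.prod_mul_distrib, Finset.prod_pow_eq_pow_sum, Finset.prod_pow_eq_pow_sum, hm, hn]
      at hb
    have hne : x ^ (∑ k, p (Fin.castLE hcl k)) * y ^ (∑ k, q (Fin.castLE hcl k)) ≠ 0 :=
      mul_ne_zero (pow_ne_zero _ hx) (pow_ne_zero _ hy)
    refine mul_left_cancel₀ hne ?_
    calc _ = u * (d * b) := by rw [← hu]; ring
      _ = _ := by rw [hb, pow_add, pow_add]; ring
  have hdet : θ (U.submatrix ri ci).det = ((U.map θ).submatrix ri ci).det := by
    rw [RingHom.map_det]; rfl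
  by_cases hrc : ∀ k, (ri k : ℕ) < c
  · by_cases hct : ∀ k, (ci k : ℕ) < t
    · rw [hb', map_mul, map_mul, hdet]
      exact Ideal.mul_mem_right _ _ (Ideal.mul_mem_left _ _
        (Matrix.det_submatrix_mem_rowsIdeal _ ri ci hri hrc hct))
    · push Not at hct
      obtain ⟨k, hk⟩ := hct
      have h0 : θ b = 0 := by
        rw [hb', map_mul, map_prod, Finset.prod_eq_zero (Finset.mem_univ k), mul_zero]
        rw [if_neg (by omega), hθ]
      rw [h0]
      exact Ideal.zero_mem _
  · push Not at hrc
    have h0 : θ b = 0 := by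
      have : θ (x ^ m * y ^ n) = 0 := by
        rcases hlt ri hri hrc with h | ⟨hx0, h⟩
        · rw [map_mul, map_pow θ y, hθ, zero_pow (by omega), mul_zero]
        · rw [map_mul, map_pow, hx0, zero_pow (by omega), zero_mul]
      rw [hb', map_mul, map_mul, map_mul, this]
      simp
    rw [h0]
    exact Ideal.zero_mem _

theorem Fin.sum_castLE_le_sum_of_monotone {c l : ℕ} (h : c ≤ l) (w : Fin l → ℕ) (hw : Monotone w)
    (ri : Fin c → Fin l) (hri : Function.Injective ri) :
    ∑ k, w (Fin.castLE h k) ≤ ∑ k, w (ri k) := by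
  by_cases hc : c < l
  · exact Fin.sum_castLE_le_sum h w (w ⟨c, hc⟩) (fun j hj => hw (Fin.le_def.mpr hj.le))
      (fun j hj => hw (Fin.le_def.mpr hj)) ri hri
  · exact Fin.sum_castLE_le_sum h w (∑ j, w j)
      (fun j _ => Finset.single_le_sum (fun _ _ => Nat.zero_le _) (Finset.mem_univ j))
      (fun j hj => absurd j.2 (by omega)) ri hri

theorem Nat.exists_threshold (p : ℕ → Prop) (t : ℕ)
    (hp : ∀ i j, i ≤ j → j < t → p j → p i) :
    ∃ a ≤ t, (∀ j < a, p j) ∧ ∀ j, a ≤ j → j < t → ¬ p j := by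
  induction t with
  | zero => exact ⟨0, le_rfl, by simp, by simp⟩
  | succ t ih =>
    by_cases ht : p t
    · exact ⟨t + 1, le_rfl, fun j hj => hp j t (by omega) (by omega) ht, fun j _ _ => by omega⟩
    · obtain ⟨a, hat, h1, h2⟩ := ih fun i j hij hj => hp i j hij (by omega)
      refine ⟨a, by omega, h1, fun j haj hj => ?_⟩
      rcases Nat.lt_succ_iff_lt_or_eq.mp hj with hj | rfl
      · exact h2 j haj hj
      · exact ht

namespace MvPolynomial

/-- The substitution of `0` for the variable `v`. -/
noncomputable def evalVarZero {σ : Type*} [DecidableEq σ] (K : Type*) [CommRing K] (v : σ) :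
    MvPolynomial σ K →ₐ[K] MvPolynomial σ K :=
  aeval fun i => if i = v then 0 else X i

variable {σ : Type*} [DecidableEq σ] {K : Type*} [CommRing K] (v : σ)

@[simp]
theorem evalVarZero_X_self : evalVarZero K v (X v) = 0 := by
  simp [evalVarZero]

theorem evalVarZero_X_of_ne {w : σ} (h : w ≠ v) : evalVarZero K v (X w) = X w := by
  simp [evalVarZero, h]

theorem evalVarZero_evalVarZero (z : MvPolynomial σ K) :
    evalVarZero K v (evalVarZero K v z) = evalVarZero K v z := by
  have h : (evalVarZero K v).comp (evalVarZero K v) = evalVarZero K v := by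
    ext1 i
    by_cases hi : i = v
    · subst hi
      simp
    · simp [evalVarZero_X_of_ne v hi]
  exact DFunLike.congr_fun h z

theorem X_dvd_sub_evalVarZero (z : MvPolynomial σ K) : X v ∣ z - evalVarZero K v z := by
  rw [← Ideal.mem_span_singleton, ← Ideal.Quotient.eq]
  have h : (Ideal.Quotient.mkₐ K (Ideal.span {(X v : MvPolynomial σ K)})) =
      (Ideal.Quotient.mkₐ K (Ideal.span {(X v : MvPolynomial σ K)})).comp (evalVarZero K v) := by
    ext1 i
    by_cases hi : i = v
    · subst hi
      simp
    · simp [evalVarZero_X_of_ne v hi]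
  exact DFunLike.congr_fun h z

theorem evalVarZero_of_mem_supported {z : MvPolynomial σ K}
    (hz : z ∈ supported K (({v} : Set σ)ᶜ)) : evalVarZero K v z = z := by
  have h : supported K (({v} : Set σ)ᶜ) ≤
      AlgHom.equalizer (evalVarZero K v) (AlgHom.id K (MvPolynomial σ K)) := by
    refine Algebra.adjoin_le ?_
    rintro _ ⟨i, hi, rfl⟩
    exact evalVarZero_X_of_ne v hi
  exact h hz

end MvPolynomial

namespace Matrix

variable {A : Type*} [CommRing A] {l : ℕ}

theorem row_inv_eq_one {M : Matrix (Fin l) (Fin l) A} (hM : IsUnit M.det) {i : Fin l}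
    (h : ∀ j, M i j = (1 : Matrix (Fin l) (Fin l) A) i j) (j : Fin l) :
    M⁻¹ i j = (1 : Matrix (Fin l) (Fin l) A) i j := by
  rw [← mul_apply_of_row_eq_one h M⁻¹ j, Matrix.mul_nonsing_inv _ hM]

theorem map_one_apply (ψ : A →+* A) (i j : Fin l) :
    ψ ((1 : Matrix (Fin l) (Fin l) A) i j) = (1 : Matrix (Fin l) (Fin l) A) i j := by
  rw [Matrix.one_apply, apply_ite ψ, map_one, map_zero]

theorem exists_mul_mul_rows_eq_one (hA : IsHermite A) (ψ : A →+* A)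
    (hψ : ∀ z, ψ (ψ z) = ψ z) (x : A) (hx : ∀ z, x ∣ z - ψ z) {t a c : ℕ} (hac : a ≤ c)
    (hct : c ≤ t) (htl : t ≤ l) (U : Matrix (Fin l) (Fin l) A) (hU : IsUnit U.det)
    (Y : Matrix (Fin l) (Fin l) A) (hY : ∀ i k : Fin l, t ≤ i → Y i k = 0)
    (hUY : ∀ i k : Fin l, (i : ℕ) < a → (k : ℕ) < a →
      (U * Y) i k = (1 : Matrix (Fin l) (Fin l) A) i k)
    (Z : Matrix (Fin l) (Fin l) A) (hZ : ∀ i k : Fin l, t ≤ i → Z i k = 0)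
    (hUZ : ∀ i k : Fin l, (i : ℕ) < c → (k : ℕ) < c →
      (U.map ψ * Z) i k = (1 : Matrix (Fin l) (Fin l) A) i k) (N : ℕ) :
    ∃ P Q : Matrix (Fin l) (Fin l) A, IsUnit P.det ∧ IsUnit Q.det ∧
      (∀ i j : Fin l, t ≤ i → (j : ℕ) < t → Q i j = 0) ∧
      (∀ i j : Fin l, (i : ℕ) < c → P i j = (1 : Matrix (Fin l) (Fin l) A) i j) ∧
      (∀ i j : Fin l, (i : ℕ) < a → (P * U * Q) i j = (1 : Matrix (Fin l) (Fin l) A) i j) ∧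
      ∀ i j, i < j → x ^ (N + 1) ∣ (P * U * Q) i j := by
  let Ψ : Matrix (Fin l) (Fin l) A →+* Matrix (Fin l) (Fin l) A := ψ.mapMatrix
  have hΨ : ∀ F, Ψ (Ψ F) = Ψ F := fun F => by
    ext i j
    simp [Ψ, hψ]
  have hΨa : ∀ F i j, Ψ F i j = ψ (F i j) := fun F i j => rfl
  have hΨdet : ∀ F, IsUnit F.det → IsUnit (Ψ F).det := fun F hF => by
    have := hF.map ψ
    rwa [RingHom.map_det] at this
  obtain ⟨Q₁, hQ₁det, hQ₁, hUQ₁⟩ := exists_mul_rows_eq_one hA htl U Y hY a (hac.trans hct) hUY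
  set U₁ := U * Q₁ with hU₁
  have hΨQ₁ : ∀ i j : Fin l, t ≤ i → (j : ℕ) < t → Ψ Q₁ i j = 0 := fun i j hi hj => by
    rw [hΨa, hQ₁ i j hi hj, map_zero]
  obtain ⟨Q₂, hQ₂det, hQ₂, hUQ₂⟩ := exists_mul_rows_eq_one hA htl (Ψ U₁) ((Ψ Q₁)⁻¹ * Z)
    (rows_mul_of_lowerRows_zero (lowerLeft_inv (hΨdet _ hQ₁det) hΨQ₁) hZ) c hct (by
      intro i k hi hk
      rw [← hUZ i k hi hk, hU₁, map_mul, Matrix.mul_assoc, ← Matrix.mul_assoc (Ψ Q₁),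
        Matrix.mul_nonsing_inv _ (hΨdet _ hQ₁det), Matrix.one_mul]
      rfl)
  set U₂ := U₁ * Ψ Q₂ with hU₂
  have hU₂det : IsUnit U₂.det := by
    rw [hU₂, hU₁, Matrix.det_mul, Matrix.det_mul]
    exact (hU.mul hQ₁det).mul (hΨdet _ hQ₂det)
  have hΨU₁ : ∀ i j : Fin l, (i : ℕ) < a → Ψ U₁ i j = (1 : Matrix (Fin l) (Fin l) A) i j := by
    intro i j hi
    rw [hΨa, hUQ₁ i j hi, map_one_apply]
  have hU₂row : ∀ i j : Fin l, (i : ℕ) < a → U₂ i j = (1 : Matrix (Fin l) (Fin l) A) i j := by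
    intro i j hi
    rw [hU₂, mul_apply_of_row_eq_one (fun j => hUQ₁ i j hi), hΨa,
      ← mul_apply_of_row_eq_one (fun j => hΨU₁ i j hi) Q₂ j, hUQ₂ i j (by omega), map_one_apply]
  have hΨU₂ : ∀ i j : Fin l, (i : ℕ) < c → Ψ U₂ i j = (1 : Matrix (Fin l) (Fin l) A) i j := by
    intro i j hi
    have : Ψ U₂ = Ψ (Ψ U₁ * Q₂) := by rw [hU₂, map_mul, map_mul Ψ (Ψ U₁), hΨ, hΨ]
    rw [this, hΨa, hUQ₂ i j hi, map_one_apply]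
  have hP := fun i j hi => row_inv_eq_one (hΨdet _ hU₂det) (fun j => hΨU₂ i j hi) j
  set P := (Ψ U₂)⁻¹ with hPdef
  have hMone : Ψ (P * U₂) = 1 := by
    have h1 : Ψ U₂ * P = 1 := Matrix.mul_nonsing_inv _ (hΨdet _ hU₂det)
    have h2 := congrArg Ψ h1
    rw [map_mul, map_one, hΨ] at h2
    rw [map_mul]
    exact mul_eq_one_comm.mp h2
  obtain ⟨T, hTdet, hT, -, hT₂, hT₃⟩ := exists_mul_lowerTriangular_mod x a (P * U₂)
    (fun i j => by
      rw [← hMone, Matrix.sub_apply, hΨa]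
      exact hx _)
    (fun i j hi => by
      rw [mul_apply_of_row_eq_one (fun j => hP i j (by omega)), hU₂row i j hi]) N
  have hPUQ : P * U * (Q₁ * Ψ Q₂ * T) = P * U₂ * T := by
    simp only [hU₂, hU₁, Matrix.mul_assoc]
  refine ⟨P, Q₁ * Ψ Q₂ * T, ?_, ?_, lowerLeft_mul (lowerLeft_mul hQ₁ ?_) ?_, hP, ?_, ?_⟩
  · exact Matrix.isUnit_nonsing_inv_det _ (hΨdet _ hU₂det)
  · rw [Matrix.det_mul, Matrix.det_mul, hTdet, mul_one]
    exact hQ₁det.mul (hΨdet _ hQ₂det)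
  · intro i j hi hj
    rw [hΨa, hQ₂ i j hi hj, map_zero]
  · intro i j hi hj
    exact hT i j (Fin.lt_def.mpr (by omega))
  · rw [hPUQ]
    exact hT₃
  · rw [hPUQ]
    exact hT₂

end Matrix

theorem MatEquiv.of_mul_mul_rows_eq_one {R : Type*} [CommRing R] [IsDomain R] {x y : R}
    (hx : x ≠ 0) (hy : y ≠ 0) {t a c l : ℕ} (p q : Fin l → ℕ) (hp : Monotone p)
    (hq : Monotone q) (rE sE : ℕ) (hpE : ∀ j, p j ≤ rE)
    (hqa : ∀ j : Fin l, a ≤ j → q j = sE)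
    (hpqc : ∀ j : Fin l, c ≤ j → p j = rE ∧ q j = sE)
    (U P Q : Matrix (Fin l) (Fin l) R) (hPdet : IsUnit P.det) (hUdet : IsUnit U.det)
    (hQdet : IsUnit Q.det)
    (hQ : ∀ i j : Fin l, t ≤ i → (j : ℕ) < t → Q i j = 0)
    (hP : ∀ i j : Fin l, (i : ℕ) < c → P i j = (1 : Matrix (Fin l) (Fin l) R) i j)
    (hPUQ : ∀ i j : Fin l, (i : ℕ) < a →
      (P * U * Q) i j = (1 : Matrix (Fin l) (Fin l) R) i j)
    (hPUQx : ∀ i j, i < j → x ^ (rE + 1) ∣ (P * U * Q) i j) :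
    MatEquiv (Matrix.diagonal (fun j => x ^ p j * y ^ q j) * U *
        Matrix.diagonal (fun j : Fin l => if (j : ℕ) < t then 1 else y))
      (Matrix.diagonal (fun j => x ^ p j * y ^ q j) *
        Matrix.diagonal (fun j : Fin l => if (j : ℕ) < t then 1 else y)) := by
  have hd : ∀ j, x ^ p j * y ^ q j ≠ 0 := fun j =>
    mul_ne_zero (pow_ne_zero _ hx) (pow_ne_zero _ hy)
  have hdvd : ∀ {i j}, j ≤ i → x ^ p j * y ^ q j ∣ x ^ p i * y ^ q i := fun h =>
    mul_dvd_mul (pow_dvd_pow x (hp h)) (pow_dvd_pow y (hq h))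
  obtain ⟨M, hM, hMD⟩ := Matrix.exists_diagonal_mul_eq_mul_diagonal _ hd P fun i j => by
    rcases le_or_gt j i with hij | hij
    · exact (hdvd hij).mul_right _
    · rcases lt_or_ge (i : ℕ) c with hi | hi
      · rw [hP i j hi, Matrix.one_apply_ne hij.ne, mul_zero]
        exact dvd_zero _
      · obtain ⟨h1, h2⟩ := hpqc i hi
        obtain ⟨h3, h4⟩ := hpqc j (hi.trans hij.le)
        rw [h1, h2, h3, h4]
        exact dvd_mul_right _ _
  obtain ⟨M', hM', hMD'⟩ := Matrix.exists_diagonal_mul_eq_mul_diagonal _ hd (P * U * Q)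
    fun i j => by
      rcases le_or_gt j i with hij | hij
      · exact (hdvd hij).mul_right _
      · rcases lt_or_ge (i : ℕ) a with hi | hi
        · rw [hPUQ i j hi, Matrix.one_apply_ne hij.ne, mul_zero]
          exact dvd_zero _
        · rw [hqa i hi, hqa j (hi.trans hij.le), mul_right_comm]
          refine mul_dvd_mul_right (Dvd.dvd.mul_left ?_ _) _
          exact (pow_dvd_pow x ((hpE j).trans (Nat.le_succ rE))).trans (hPUQx i j hij)
  obtain ⟨N, hN, hQN⟩ := Matrix.exists_mul_diagonal_eq_diagonal_mul
    (fun j : Fin l => if (j : ℕ) < t then 1 else y) (fun j => by split_ifs <;> simp [hy]) Q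
    fun i j => by
      rcases lt_or_ge (i : ℕ) t with hi | hi
      · simp [hi]
      · rcases lt_or_ge (j : ℕ) t with hj | hj
        · simp [hQ i j hi hj]
        · simp [hi.not_gt, hj.not_gt]
  have hM'det : IsUnit M'.det := by
    rw [hM', Matrix.det_mul, Matrix.det_mul]
    exact (hPdet.mul hUdet).mul hQdet
  refine ⟨M'⁻¹ * M, N, ?_, hN ▸ hQdet, ?_⟩
  · rw [Matrix.det_mul, hM]
    exact (Matrix.isUnit_nonsing_inv_det _ hM'det).mul hPdet
  · set D := Matrix.diagonal fun j => x ^ p j * y ^ q j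
    set E := Matrix.diagonal fun j : Fin l => if (j : ℕ) < t then 1 else y
    calc D * E = M'⁻¹ * (M' * D) * E := by
          rw [← Matrix.mul_assoc, Matrix.nonsing_inv_mul _ hM'det, Matrix.one_mul]
      _ = M'⁻¹ * (D * P * U * (Q * E)) := by rw [← hMD']; simp only [Matrix.mul_assoc]
      _ = M'⁻¹ * M * (D * U * E) * N := by rw [hMD, hQN]; simp only [Matrix.mul_assoc]

/-- Let
`B = diag(x₁^{r₁}x₂^{s₁},…,x₁^{r_t}x₂^{s_t}, x₁^{rE}x₂^{sE} I_{l-t}) * U * diag(I_t, x₂ I_{l-t})`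
with `U` unimodular not involving `x₂`, `r₁ ≤ ⋯ ≤ r_t ≤ rE`, `s₁ ≤ ⋯ ≤ s_t ≤ sE`, and
`r₁ = s₁ = 0` (neither `x₁` nor `x₂` divides `d₁(B)`).  If `J_i(B) = R` and `d_i(B)` is
associated to `x₁^{r₁+⋯+r_i} x₂^{s₁+⋯+s_i}` for `i = 1,…,t`, then `B` is equivalent to
`B₁ = diag(x₁^{r₁}x₂^{s₁},…,x₁^{r_t}x₂^{s_t}, x₁^{rE}x₂^{sE+1} I_{l-t})`. -/
theorem statement11 {K : Type*} [Field K] {n l : ℕ}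
    (v1 v2 : Fin n) (hv1 : (v1 : ℕ) = 0) (hv2 : (v2 : ℕ) = 1)
    (t : ℕ) (ht1 : 1 ≤ t) (htl : t ≤ l)
    (U : Matrix (Fin l) (Fin l) (MvPolynomial (Fin n) K))
    (hU : IsUnit U.det)
    (hUx : ∀ a b, U a b ∈ MvPolynomial.supported K (({v2} : Set (Fin n))ᶜ))
    (r s : ℕ → ℕ) (rE sE : ℕ)
    (hrmono : ∀ i j, i ≤ j → j < t → r i ≤ r j)
    (hsmono : ∀ i j, i ≤ j → j < t → s i ≤ s j)
    (hrE : ∀ i < t, r i ≤ rE) (hsE : ∀ i < t, s i ≤ sE)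
    (hr0 : r 0 = 0) (hs0 : s 0 = 0)
    (B : Matrix (Fin l) (Fin l) (MvPolynomial (Fin n) K))
    (hB : B =
      Matrix.diagonal (fun j : Fin l => if (j : ℕ) < t
        then X v1 ^ r (j : ℕ) * X v2 ^ s (j : ℕ) else X v1 ^ rE * X v2 ^ sE) * U *
        Matrix.diagonal (fun j : Fin l => if (j : ℕ) < t then 1 else X v2))
    (hJ : ∀ i, 1 ≤ i → i ≤ t → JEqTop i B)
    (hd : ∀ i, 1 ≤ i → i ≤ t → ∀ d, IsGcdMinors i B d →
      Associated d
        (X v1 ^ (∑ j ∈ Finset.range i, r j) * X v2 ^ (∑ j ∈ Finset.range i, s j))) :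
    MatEquiv B
      (Matrix.diagonal (fun j : Fin l => if (j : ℕ) < t
        then X v1 ^ r (j : ℕ) * X v2 ^ s (j : ℕ) else X v1 ^ rE * X v2 ^ (sE + 1))) := by
  have hv : v1 ≠ v2 := by
    rintro rfl
    omega
  have hx : (X v1 : MvPolynomial (Fin n) K) ≠ 0 := X_ne_zero v1
  have hy : (X v2 : MvPolynomial (Fin n) K) ≠ 0 := X_ne_zero v2
  obtain ⟨p, hpdef⟩ : ∃ p : Fin l → ℕ,
      p = fun j : Fin l => if (j : ℕ) < t then r j else rE := ⟨_, rfl⟩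
  obtain ⟨q, hqdef⟩ : ∃ q : Fin l → ℕ,
      q = fun j : Fin l => if (j : ℕ) < t then s j else sE := ⟨_, rfl⟩
  have hplt : ∀ j : Fin l, (j : ℕ) < t → p j = r j := fun j hj => by rw [hpdef]; exact if_pos hj
  have hqlt : ∀ j : Fin l, (j : ℕ) < t → q j = s j := fun j hj => by rw [hqdef]; exact if_pos hj
  have hpge : ∀ j : Fin l, t ≤ j → p j = rE := fun j hj => by
    rw [hpdef]; exact if_neg hj.not_gt
  have hqge : ∀ j : Fin l, t ≤ j → q j = sE := fun j hj => by
    rw [hqdef]; exact if_neg hj.not_gt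
  have hpE : ∀ j, p j ≤ rE := fun j => by
    rcases lt_or_ge (j : ℕ) t with hj | hj
    · exact (hplt j hj).trans_le (hrE j hj)
    · exact (hpge j hj).le
  have hqE : ∀ j, q j ≤ sE := fun j => by
    rcases lt_or_ge (j : ℕ) t with hj | hj
    · exact (hqlt j hj).trans_le (hsE j hj)
    · exact (hqge j hj).le
  have hp : Monotone p := fun i j hij => by
    rcases lt_or_ge (j : ℕ) t with hj | hj
    · rw [hplt j hj, hplt i (lt_of_le_of_lt hij hj)]
      exact hrmono i j hij hj
    · exact (hpE i).trans (hpge j hj).ge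
  have hq : Monotone q := fun i j hij => by
    rcases lt_or_ge (j : ℕ) t with hj | hj
    · rw [hqlt j hj, hqlt i (lt_of_le_of_lt hij hj)]
      exact hsmono i j hij hj
    · exact (hqE i).trans (hqge j hj).ge
  obtain ⟨a, hat, ha1, ha2⟩ := Nat.exists_threshold (fun j => s j < sE) t
    fun i j hij hj h => (hsmono i j hij hj).trans_lt h
  obtain ⟨c, hct, hc1, hc2⟩ := Nat.exists_threshold (fun j => s j < sE ∨ r j < rE) t
    fun i j hij hj h => h.imp (hsmono i j hij hj).trans_lt (hrmono i j hij hj).trans_lt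
  have hac : a ≤ c := by
    by_contra! hca
    exact hc2 c le_rfl (by omega) (Or.inl (ha1 c hca))
  have hqa : ∀ j : Fin l, a ≤ j → q j = sE := fun j hj => by
    rcases lt_or_ge (j : ℕ) t with hjt | hjt
    · exact le_antisymm (hqE j) (by rw [hqlt j hjt]; exact not_lt.mp (ha2 j hj hjt))
    · exact hqge j hjt
  have hpqc : ∀ j : Fin l, c ≤ j → p j = rE ∧ q j = sE := fun j hj => by
    refine ⟨?_, hqa j (hac.trans hj)⟩
    rcases lt_or_ge (j : ℕ) t with hjt | hjt
    · have := not_or.mp (hc2 j hj hjt)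
      exact le_antisymm (hpE j) (by rw [hplt j hjt]; exact not_lt.mp this.2)
    · exact hpge j hjt
  have hBpq : B = Matrix.diagonal (fun j => X v1 ^ p j * X v2 ^ q j) * U *
      Matrix.diagonal (fun j : Fin l => if (j : ℕ) < t then 1 else X v2) := by
    rw [hB]
    congr 3
    funext j
    rw [hpdef, hqdef]
    dsimp only
    split_ifs <;> rfl
  have key : ∀ (e : ℕ) (het : e ≤ t)
      (θ : MvPolynomial (Fin n) K →+* MvPolynomial (Fin n) K), θ (X v2) = 0 →
      (∀ ri : Fin e → Fin l, Function.Injective ri → (∃ k, e ≤ (ri k : ℕ)) →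
        ∑ k, q (Fin.castLE (het.trans htl) k) < ∑ k, q (ri k) ∨
        (θ (X v1) = 0 ∧ ∑ k, p (Fin.castLE (het.trans htl) k) < ∑ k, p (ri k))) →
      ∃ Y : Matrix (Fin l) (Fin l) (MvPolynomial (Fin n) K),
        (∀ i k : Fin l, t ≤ i → Y i k = 0) ∧ ∀ i k : Fin l, (i : ℕ) < e → (k : ℕ) < e →
          (U.map θ * Y) i k = (1 : Matrix (Fin l) (Fin l) (MvPolynomial (Fin n) K)) i k := by
    intro e het θ hθ hlt
    rcases Nat.eq_zero_or_pos e with rfl | he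
    · exact ⟨0, by simp, by simp⟩
    · refine JEqTop.exists_mul_rows_eq_one θ hx hy hθ (het.trans htl) p q U B hBpq (hJ e he het)
        (fun d hdB => ?_)
        (fun ri hri => Fin.sum_castLE_le_sum_of_monotone _ p hp ri hri)
        (fun ri hri => Fin.sum_castLE_le_sum_of_monotone _ q hq ri hri) hlt
      have := hd e he het d hdB
      rw [Finset.sum_range, Finset.sum_range] at this
      rwa [Finset.sum_congr rfl fun k _ => hplt (Fin.castLE (het.trans htl) k) (k.2.trans_le het),
        Finset.sum_congr rfl fun k _ => hqlt (Fin.castLE (het.trans htl) k) (k.2.trans_le het)]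
  have hUfix : U.map (evalVarZero K v2) = U := by
    ext1 i j
    exact evalVarZero_of_mem_supported v2 (hUx i j)
  obtain ⟨Y, hY, hUY⟩ := key a hat (evalVarZero K v2 : _ →+* _) (by simp) fun ri hri hex =>
    Or.inl (Fin.sum_castLE_lt_sum _ q sE
      (fun j hj => by rw [hqlt j (hj.trans_le hat)]; exact ha1 j hj)
      (fun j hj => (hqa j hj).ge) ri hri hex)
  obtain ⟨Z, hZ, hUZ⟩ := key c hct
    ((evalVarZero K v1).comp (evalVarZero K v2) : _ →+* _) (by simp) fun ri hri hex => by
      rcases hac.eq_or_lt with rfl | hlt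
      · exact Or.inl (Fin.sum_castLE_lt_sum _ q sE
          (fun j hj => by rw [hqlt j (hj.trans_le hat)]; exact ha1 j hj)
          (fun j hj => (hqa j hj).ge) ri hri hex)
      · refine Or.inr ⟨by simp [evalVarZero_X_of_ne v2 hv], Fin.sum_castLE_lt_sum _ p rE
          (fun j hj => ?_) (fun j hj => (hpqc j hj).1.ge) ri hri hex⟩
        rw [hplt j (hj.trans_le hct)]
        refine (hrmono j (c - 1) (by omega) (by omega)).trans_lt ?_
        exact (hc1 (c - 1) (by omega)).resolve_left (ha2 (c - 1) (by omega) (by omega))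
  have hUθ : U.map (evalVarZero K v2 : MvPolynomial (Fin n) K →+* MvPolynomial (Fin n) K) = U :=
    hUfix
  have hUψθ : U.map ((evalVarZero K v1).comp (evalVarZero K v2) :
      MvPolynomial (Fin n) K →+* MvPolynomial (Fin n) K) =
      U.map (evalVarZero K v1 : MvPolynomial (Fin n) K →+* MvPolynomial (Fin n) K) := by
    ext1 i j
    exact congrArg (evalVarZero K v1) (evalVarZero_of_mem_supported v2 (hUx i j))
  rw [hUθ] at hUY
  rw [hUψθ] at hUZ
  obtain ⟨ψ, hψ⟩ : ∃ ψ : MvPolynomial (Fin n) K →+* MvPolynomial (Fin n) K,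
      ψ = (evalVarZero K v1 : MvPolynomial (Fin n) K →+* MvPolynomial (Fin n) K) := ⟨_, rfl⟩
  have hψψ : ∀ z, ψ (ψ z) = ψ z := fun z => by
    rw [hψ]
    exact evalVarZero_evalVarZero v1 z
  have hψX : ∀ z, X v1 ∣ z - ψ z := fun z => by
    rw [hψ]
    exact X_dvd_sub_evalVarZero v1 z
  rw [← hψ] at hUZ
  obtain ⟨P, Q, hPdet, hQdet, hQ, hP, hPUQ, hPUQx⟩ := Matrix.exists_mul_mul_rows_eq_one
    (MvPolynomial.isHermite K n) ψ hψψ (X v1) hψX hac hct htl U hU Y hY hUY Z hZ hUZ rE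
  have hequiv := MatEquiv.of_mul_mul_rows_eq_one hx hy p q hp hq rE sE hpE hqa hpqc U P Q hPdet hU
    hQdet hQ hP hPUQ hPUQx
  rw [← hBpq, Matrix.diagonal_mul_diagonal] at hequiv
  convert hequiv using 3 with j
  rw [hpdef, hqdef]
  dsimp only
  split_ifs
  · rw [mul_one]
  · rw [pow_succ, mul_assoc]
end
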